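/- arXiv:2508.12041 — 5 statements merged into one kernel-verified Lean document; each statement's English description precedes it below -/
import Mathlib

section
/- On the module L(n) of the context, set p := n mod 2 ∈ {0,1}, and define the operators T' := Σ_{m ≥ 0, 2m+p ≤ n} (−1)^m q^{−m} B^{(2m+p)}_{p̄} and T'' := Σ_{m ≥ 0, 2m+p ≤ n} (−1)^m q^{m} B^{(2m+p)}_{p̄} on V. Then T' ∘ T'' = T'' ∘ T' = id_V. (These are the integral relative braid group operators in split rank one, and they are mutually inverse.) -/
set_option synthInstance.maxHeartbeats 1000000
set_option maxHeartbeats 2000000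

noncomputable section

namespace Lnmod

/-- The base field `F = ℚ(q)`. -/
abbrev F : Type := RatFunc ℚ

/-- `q^e` for `e : ℤ`. -/
def qz (e : ℤ) : F := (RatFunc.X : F) ^ e

/-- The quantum integer `[n]`. -/
def qint (n : ℤ) : F := (qz n - qz (-n)) / (qz 1 - qz (-1))

/-- The quantum factorial `[n]!`. -/
def qfact (n : ℕ) : F := ∏ i ∈ Finset.range n, qint ((i : ℤ) + 1)

/-- The balanced Gaussian binomial coefficient in the variable `q²`. -/
def qbinom2 (a : ℤ) (k : ℕ) : F :=
  ∏ s ∈ Finset.range k,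
    (qz (2 * (a - s)) - qz (-(2 * (a - s)))) /
      (qz (2 * ((s : ℤ) + 1)) - qz (-(2 * ((s : ℤ) + 1))))

/-- The underlying space of the simple `U_q(sl₂)`-module `L(n)`, with basis `v₀, …, v_n`. -/
abbrev V (n : ℕ) : Type := Fin (n + 1) → F

/-- The basis vector `v_k` of `L(n)`. -/
def vb (n : ℕ) (k : Fin (n + 1)) : V n := Pi.single k 1

/-- The operator `F` on `L(n)`: `F(v_k) = [k+1]·v_{k+1}` (and `v_{n+1} = 0`). -/
def Fop (n : ℕ) : Module.End F (V n) :=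
  Matrix.toLin'
    (Matrix.of fun i j : Fin (n + 1) =>
      if (i : ℕ) = (j : ℕ) + 1 then qint ((j : ℕ) + 1) else 0)

/-- The operator `E` on `L(n)`: `E(v_k) = [n+1−k]·v_{k−1}` (and `v_{−1} = 0`). -/
def Eop (n : ℕ) : Module.End F (V n) :=
  Matrix.toLin'
    (Matrix.of fun i j : Fin (n + 1) =>
      if (i : ℕ) + 1 = (j : ℕ) then qint ((n : ℤ) + 1 - (j : ℕ)) else 0)

/-- The operator `K⁻¹` on `L(n)`: `K⁻¹(v_k) = q^{−(n−2k)}·v_k`. -/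
def Kinvop (n : ℕ) : Module.End F (V n) :=
  Matrix.toLin'
    (Matrix.of fun i j : Fin (n + 1) =>
      if i = j then qz (-((n : ℤ) - 2 * (i : ℕ))) else 0)

/-- `B := F + q^{−1}·E·K^{−1}`. -/
def Bop (n : ℕ) : Module.End F (V n) := Fop n + qz (-1) • (Eop n * Kinvop n)

/-- The idivided powers `B^{(m)}_{p̄}` of an element `B`, with parameter `ς = q^{−1}`:
`B^{(0)}_{p̄} = 1`; for `m ≥ 1`,
`B^{(m)}_{0̄} = (1/[m]!)·B^{1+δ}·∏_{r=1}^{⌈m/2⌉−1}(B² − [2r]²·1)` (δ = 1 iff m even), and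
`B^{(m)}_{1̄} = (1/[m]!)·B^{ε}·∏_{r=1}^{⌊m/2⌋}(B² − [2r−1]²·1)` (ε = 1 iff m odd);
`B^{(m)}_{p̄} = 0` for `m < 0`. -/
def idp {A : Type*} [Ring A] [Algebra F A] (B : A) (p : ZMod 2) (m : ℤ) : A :=
  if m < 0 then 0
  else if m = 0 then 1
  else if p = 0 then
    (qfact m.toNat)⁻¹ •
      (B ^ (if m % 2 = 0 then 2 else 1) *
        ((List.range ((m.toNat + 1) / 2 - 1)).map
            (fun r => B ^ 2 - (qint (2 * ((r : ℤ) + 1)) ^ 2) • (1 : A))).prod)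
  else
    (qfact m.toNat)⁻¹ •
      (B ^ (if m % 2 = 0 then 0 else 1) *
        ((List.range (m.toNat / 2)).map
            (fun r => B ^ 2 - (qint (2 * ((r : ℤ) + 1) - 1) ^ 2) • (1 : A))).prod)

end Lnmod

open Lnmod

namespace Lnmod

section SymmetricBracket

variable {K : Type*} [Field K]

/-- The symmetric quantum integer `[k]` at a parameter `q` of a field. -/
def bracket (q : K) (k : ℤ) : K := (q ^ k - q ^ (-k)) / (q - q⁻¹)

lemma bracket_neg (q : K) (k : ℤ) : bracket q (-k) = -bracket q k := by
  simp only [bracket, neg_neg]; ring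

lemma bracket_inv (q : K) (k : ℤ) : bracket q⁻¹ k = bracket q k := by
  simp only [bracket, inv_zpow', inv_inv, neg_neg]
  rw [← neg_sub (q ^ k), ← neg_sub q, neg_div_neg_eq]

lemma bracket_sq_sub_sq {q : K} (hq : q ≠ 0) (a b : ℤ) :
    bracket q a ^ 2 - bracket q b ^ 2 = bracket q (a - b) * bracket q (a + b) := by
  have ha := zpow_ne_zero a hq
  have hb := zpow_ne_zero b hq
  simp only [bracket, div_pow, div_mul_div_comm, ← sub_div, ← pow_two (q - q⁻¹)]
  congr 1
  simp only [neg_sub, neg_add, zpow_sub₀ hq, zpow_add₀ hq, zpow_neg]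
  field_simp
  ring

lemma bracket_telescope {q : K} (hq : q ≠ 0) (N : ℤ) (M e : ℕ) :
    q ^ (M + e) * (1 + q ^ (-2 * (N + 1))) *
        (bracket q (2 * M + 1 + e) * bracket q (2 * M + 2 + e)) -
      q ^ (-(M + 1 : ℤ)) * (bracket q (N + 2) * bracket q (N + 1 + (2 * M + 1 + e)) +
        q ^ (-2 * (N + 1)) * (bracket q N * bracket q (N + 1 - (2 * M + 1 + e)))) =
      -(q ^ (M + 1 + e) * (1 + q ^ (-2 * (N + 1))) *
        (bracket q (N + 1 - (2 * M + 1 + e)) * bracket q (N + 1 + (2 * M + 1 + e)))) := by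
  obtain ⟨n, rfl⟩ : ∃ n, N = n - 1 := ⟨N + 1, by ring⟩
  have hn := zpow_ne_zero n hq
  have hM := pow_ne_zero M hq
  have he := pow_ne_zero e hq
  simp only [bracket, div_mul_div_comm]
  have e1 : q ^ (2 * (M : ℤ) + 1 + e) = q ^ M * q ^ M * q * q ^ e := by
    rw [zpow_add₀ hq, zpow_add₀ hq, two_mul, zpow_add₀ hq]; simp
  have e2 : q ^ (2 * (M : ℤ) + 2 + e) = q ^ M * q ^ M * q * q * q ^ e := by
    rw [show (2 * (M : ℤ) + 2 + e) = 2 * (M : ℤ) + 1 + e + 1 by ring, zpow_add₀ hq, e1]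
    simp; ring
  have e3 : q ^ (-2 * (n - 1 + 1)) = (q ^ n * q ^ n)⁻¹ := by
    rw [← zpow_add₀ hq, ← zpow_neg]; congr 1; ring
  have e4 : q ^ (-(M + 1 : ℤ)) = (q ^ M * q)⁻¹ := by
    rw [zpow_neg, zpow_add₀ hq]; simp
  have e5 : q ^ (n - 1 + 2) = q ^ n * q := by
    rw [show n - 1 + 2 = n + 1 by ring, zpow_add₀ hq]; simp
  have e6 : q ^ (n - 1 + 1 + (2 * (M : ℤ) + 1 + e)) = q ^ n * (q ^ M * q ^ M * q * q ^ e) := by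
    rw [← e1, ← zpow_add₀ hq]; congr 1; ring
  have e7 : q ^ (n - 1 + 1 - (2 * (M : ℤ) + 1 + e)) = q ^ n / (q ^ M * q ^ M * q * q ^ e) := by
    rw [← e1, ← zpow_sub₀ hq]; congr 1; ring
  have e8 : q ^ (n - 1) = q ^ n / q := by rw [zpow_sub₀ hq]; simp
  simp only [zpow_neg q (2 * (M : ℤ) + 1 + e), zpow_neg q (2 * (M : ℤ) + 2 + e),
    zpow_neg q (n - 1 + 2), zpow_neg q (n - 1 + 1 + (2 * (M : ℤ) + 1 + e)),
    zpow_neg q (n - 1 + 1 - (2 * (M : ℤ) + 1 + e)), zpow_neg q (n - 1),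
    e1, e2, e3, e4, e5, e6, e7, e8, pow_add, pow_one, ← mul_div_assoc, ← add_div, ← sub_div,
    ← neg_div]
  congr 1
  generalize q ^ n = u at *
  generalize q ^ M = w at *
  generalize q ^ e = v at *
  field_simp
  ring

lemma bracket_add_two {q : K} (hq : q ≠ 0) (N : ℤ) :
    bracket q (N + 2) + q ^ (-2 * (N + 1)) * bracket q N =
      q * (1 + q ^ (-2 * (N + 1))) * bracket q (N + 1) := by
  have hn := zpow_ne_zero N hq
  have e1 : q ^ (-2 * (N + 1)) = (q ^ N * q * (q ^ N * q))⁻¹ := by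
    rw [← zpow_add_one₀ hq, ← zpow_add₀ hq, ← zpow_neg]; congr 1; ring
  have e2 : q ^ (N + 2) = q ^ N * q * q := by
    rw [← zpow_add_one₀ hq, ← zpow_add_one₀ hq]; congr 1; ring
  simp only [bracket, zpow_neg q (N + 2), zpow_neg q (N + 1), zpow_neg q N, e1, e2,
    zpow_add_one₀ hq, ← mul_div_assoc, ← add_div]
  congr 1
  field_simp
  ring

/-- Summation by creative telescoping, with certificate `W`. -/
lemma alternating_sum_telescope {q : K} (hq : q ≠ 0) (e : ℕ) (N : ℤ) (x y W : ℕ → K)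
    (hx : ∀ M : ℕ, x (M + 1) = bracket q N * bracket q (N + 1 - (2 * M + 1 + e)) * W M)
    (hy : ∀ M : ℕ, y (M + 1) = bracket q (N + 2) * bracket q (N + 1 + (2 * M + 1 + e)) * W M)
    (hW : ∀ M : ℕ, W (M + 1) * (bracket q (2 * M + 3 + e) * bracket q (2 * M + 4 + e)) =
      W M * (bracket q (N + 1 - (2 * M + 1 + e)) * bracket q (N + 1 + (2 * M + 1 + e))))
    (h0 : y 0 + q ^ (-2 * (N + 1)) * x 0 =
      q ^ e * (1 + q ^ (-2 * (N + 1))) * W 0 * (bracket q (1 + e) * bracket q (2 + e)))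
    (M : ℕ) :
    ∑ m ∈ Finset.range (M + 1), (-1) ^ m * q ^ (-(m : ℤ)) * (y m + q ^ (-2 * (N + 1)) * x m) =
      (-1) ^ M * q ^ (M + e) * (1 + q ^ (-2 * (N + 1))) * W M *
        (bracket q (2 * M + 1 + e) * bracket q (2 * M + 2 + e)) := by
  induction M with
  | zero => simpa using h0
  | succ M ih =>
    rw [Finset.sum_range_succ, ih, hx, hy]
    have key := bracket_telescope hq N M e
    have hW' := hW M
    push_cast
    rw [show (2 * ((M : ℤ) + 1) + 1 + e) = 2 * M + 3 + e by ring,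
      show (2 * ((M : ℤ) + 1) + 2 + e) = 2 * M + 4 + e by ring]
    linear_combination (-1) ^ M * W M * key +
      (-1) ^ M * q ^ (M + 1 + e) * (1 + q ^ (-2 * (N + 1))) * hW'

end SymmetricBracket

lemma qz_injective : Function.Injective qz := by
  have hX : (RatFunc.X : F) ≠ 0 := RatFunc.X_ne_zero
  have hnat : ∀ k : ℕ, (RatFunc.X : F) ^ k = 1 → k = 0 := by
    intro k hk
    have h : (Polynomial.X : Polynomial ℚ) ^ k = 1 := by
      apply RatFunc.algebraMap_injective ℚ
      simpa [RatFunc.algebraMap_X] using hk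
    simpa using congrArg Polynomial.natDegree h
  intro a b hab
  have h1 : (RatFunc.X : F) ^ (a - b) = 1 := by
    rw [zpow_sub₀ hX]; exact (div_eq_one_iff_eq (zpow_ne_zero _ hX)).2 hab
  rcases Int.eq_nat_or_neg (a - b) with ⟨k, hk | hk⟩
  · rw [hk, zpow_natCast] at h1
    have := hnat k h1
    omega
  · rw [hk, zpow_neg, zpow_natCast, inv_eq_one] at h1
    have := hnat k h1
    omega

lemma qz_zero : qz 0 = 1 := by simp [qz]

lemma qz_add (a b : ℤ) : qz (a + b) = qz a * qz b := zpow_add₀ RatFunc.X_ne_zero a b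

lemma qz_ne_zero (a : ℤ) : qz a ≠ 0 := zpow_ne_zero a RatFunc.X_ne_zero

lemma qz_sub_ne_zero : qz 1 - qz (-1) ≠ 0 := by
  rw [sub_ne_zero]; exact qz_injective.ne (by norm_num)

lemma qint_eq_bracket (k : ℤ) : qint k = bracket (RatFunc.X : F) k := by
  simp [qint, bracket, qz]

lemma qint_injective : Function.Injective qint := by
  intro a b hab
  have h : qz a - qz (-a) = qz b - qz (-b) := by
    simpa [qint, div_left_inj' qz_sub_ne_zero] using hab
  have ha : qz a * qz (-a) = 1 := by rw [← qz_add]; simp [qz_zero]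
  have hb : qz b * qz (-b) = 1 := by rw [← qz_add]; simp [qz_zero]
  have hf : (qz a - qz b) * (qz a * qz b + 1) = 0 := by
    linear_combination qz a * qz b * h + qz b * ha - qz a * hb
  rcases mul_eq_zero.1 hf with h1 | h1
  · exact qz_injective (sub_eq_zero.1 h1)
  · exfalso
    have h2 : qz (a + b) = -1 := by rw [qz_add]; linear_combination h1
    have h3 : qz (a + b + (a + b)) = qz 0 := by rw [qz_add, h2, qz_zero]; norm_num
    have h4 : a + b = 0 := by have := qz_injective h3; omega
    rw [h4, qz_zero] at h2
    norm_num at h2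

lemma qint_zero : qint 0 = 0 := by simp [qint]

lemma qint_one : qint 1 = 1 := div_self qz_sub_ne_zero

lemma qint_ne_zero {k : ℤ} (hk : k ≠ 0) : qint k ≠ 0 := by
  rw [← qint_zero]; exact qint_injective.ne hk

lemma qfact_succ (k : ℕ) : qfact (k + 1) = qfact k * qint (k + 1) :=
  Finset.prod_range_succ _ _

lemma map_idp {A A' : Type*} [Ring A] [Algebra F A] [Ring A'] [Algebra F A'] (φ : A →ₐ[F] A')
    (B : A) (p : ZMod 2) (m : ℤ) : φ (idp B p m) = idp (φ B) p m := by
  unfold idp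
  split_ifs <;> simp [map_list_prod, List.map_map, Function.comp_def]

lemma idp_zero_even_two (l : F) : idp l 0 2 = l ^ 2 * (qint 2)⁻¹ := by
  simp [idp, qfact, Finset.prod_range_succ, qint_one, mul_comm]

lemma flatMap_intCast (l : List ℕ) : l.flatMap (fun a : ℕ => [(a : ℤ)]) = l.map (↑) :=
  List.map_eq_flatMap.symm

lemma idp_zero_even (l : F) (M : ℕ) :
    idp l 0 (2 * ((M + 1 : ℕ) : ℤ)) = (qfact (2 * M + 2))⁻¹ * (l ^ 2 *
      ((List.range M).map (fun r : ℕ => l ^ 2 - qint (2 * ((r : ℤ) + 1)) ^ 2)).prod) := by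
  have h : (2 * ((M + 1 : ℕ) : ℤ)).toNat = 2 * M + 2 := by omega
  rw [idp, if_neg (by omega), if_neg (by omega), if_pos rfl, if_pos (by omega), h,
    show (2 * M + 2 + 1) / 2 - 1 = M by omega]
  simp [flatMap_intCast, Function.comp_def]

lemma idp_one_odd (l : F) (M : ℕ) :
    idp l 1 (2 * (M : ℤ) + 1) = (qfact (2 * M + 1))⁻¹ * (l *
      ((List.range M).map (fun r : ℕ => l ^ 2 - qint (2 * ((r : ℤ) + 1) - 1) ^ 2)).prod) := by
  have h : (2 * (M : ℤ) + 1).toNat = 2 * M + 1 := by omega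
  have h1 : ¬ (1 : ZMod 2) = 0 := by decide
  rw [idp, if_neg (by omega), if_neg (by omega), if_neg h1, if_neg (by omega), h,
    show (2 * M + 1) / 2 = M by omega]
  simp [flatMap_intCast, Function.comp_def]

lemma idp_zero_add_two (l : F) (M : ℕ) :
    idp l 0 (2 * ((M + 1 + 1 : ℕ) : ℤ)) = idp l 0 (2 * ((M + 1 : ℕ) : ℤ)) *
      (l ^ 2 - qint (2 * M + 2) ^ 2) / (qint (2 * M + 3) * qint (2 * M + 4)) := by
  rw [idp_zero_even, idp_zero_even, List.range_succ, List.map_append, List.prod_append,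
    show 2 * (M + 1) + 2 = 2 * M + 2 + 1 + 1 by ring, qfact_succ, qfact_succ]
  push_cast
  rw [show (2 * (M : ℤ) + 2 + 1) = 2 * M + 3 by ring, show (2 * (M : ℤ) + 3 + 1) = 2 * M + 4 by ring]
  simp only [List.map_cons, List.map_nil, List.prod_cons, List.prod_nil, mul_one,
    mul_inv, div_eq_mul_inv, show 2 * ((M : ℤ) + 1) = 2 * M + 2 by ring]
  ring

lemma idp_one_add_two (l : F) (M : ℕ) :
    idp l 1 (2 * ((M + 1 : ℕ) : ℤ) + 1) = idp l 1 (2 * (M : ℤ) + 1) *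
      (l ^ 2 - qint (2 * M + 1) ^ 2) / (qint (2 * M + 2) * qint (2 * M + 3)) := by
  rw [idp_one_odd, idp_one_odd, List.range_succ, List.map_append, List.prod_append,
    show 2 * (M + 1) + 1 = 2 * M + 1 + 1 + 1 by ring, qfact_succ, qfact_succ]
  push_cast
  rw [show (2 * (M : ℤ) + 1 + 1) = 2 * M + 2 by ring, show (2 * (M : ℤ) + 2 + 1) = 2 * M + 3 by ring]
  simp only [List.map_cons, List.map_nil, List.prod_cons, List.prod_nil, mul_one,
    mul_inv, div_eq_mul_inv, show 2 * ((M : ℤ) + 1) - 1 = 2 * M + 1 by ring]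
  ring

lemma idp_zero_zero (l : F) : idp l 0 0 = 1 := by simp [idp]

lemma idp_one_one (l : F) : idp l 1 1 = l := by
  simp [idp, qfact, qint_one]


lemma qint_sq_sub_sq (a b : ℤ) : qint a ^ 2 - qint b ^ 2 = qint (a - b) * qint (a + b) := by
  simpa only [qint_eq_bracket] using bracket_sq_sub_sq (RatFunc.X_ne_zero (K := ℚ)) a b

lemma qint_neg (k : ℤ) : qint (-k) = -qint k := by
  simp only [qint_eq_bracket, bracket_neg]

lemma idp_add_two {e : ℕ} (he : e < 2) (l : F) (M : ℕ) :
    idp l (e : ZMod 2) (2 * ((M + 1 + 1 : ℕ) : ℤ) + e) =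
      idp l (e : ZMod 2) (2 * ((M + 1 : ℕ) : ℤ) + e) *
        (l ^ 2 - qint (2 * M + 2 + e) ^ 2) / (qint (2 * M + 3 + e) * qint (2 * M + 4 + e)) := by
  interval_cases e
  · simpa using idp_zero_add_two l M
  · have h := idp_one_add_two l (M + 1)
    push_cast at h ⊢
    rw [h]
    ring_nf

lemma idp_first {e : ℕ} (he : e < 2) (N : ℤ) :
    idp (qint N) (e : ZMod 2) (2 * ((0 + 1 : ℕ) : ℤ) + e) =
      qint N * (qint (N - e) * qint (N + e) ^ e) / (qint 2 * qint 3 ^ e) := by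
  interval_cases e
  · simp [idp_zero_even_two, pow_two, div_eq_mul_inv]
  · have h := idp_one_add_two (qint N) 0
    rw [qint_sq_sub_sq] at h
    simpa [idp_one_one] using h

/-- The sum of the idivided powers of `l` of parity `e`, weighted by `(-1)^m Q^{-m}`. -/
def braidSum {A : Type*} [Ring A] [Algebra F A] (Q : F) (e d : ℕ) (l : A) : A :=
  ∑ m ∈ Finset.range (d + 1),
    ((-1 : F) ^ m * Q ^ (-(m : ℤ))) • idp l (e : ZMod 2) (2 * (m : ℤ) + e)

lemma map_braidSum {A A' : Type*} [Ring A] [Algebra F A] [Ring A'] [Algebra F A']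
    (φ : A →ₐ[F] A') (Q : F) (e d : ℕ) (l : A) :
    φ (braidSum Q e d l) = braidSum Q e d (φ l) := by
  simp only [braidSum, map_sum, map_smul, map_idp]

lemma braidSum_qint_add_two {Q : F} (hQ : Q ≠ 0) (hb : ∀ k, bracket Q k = qint k)
    {e : ℕ} (he : e < 2) {a d : ℕ} (had : a < d) :
    braidSum Q e d (qint (2 * a + e + 2)) =
      -Q ^ (-2 * (2 * (a : ℤ) + e + 1)) * braidSum Q e d (qint (2 * a + e)) := by
  set N : ℤ := 2 * a + e with hN
  set W : ℕ → F := fun M => qint (N + 1) ^ e / (qint 2 * qint 3 ^ e) *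
    ∏ r ∈ Finset.range M, (qint (N + 1 - (2 * r + 1 + e)) * qint (N + 1 + (2 * r + 1 + e))) /
      (qint (2 * r + 3 + e) * qint (2 * r + 4 + e)) with hWdef
  have hWs (M : ℕ) : W (M + 1) = W M *
      ((qint (N + 1 - (2 * M + 1 + e)) * qint (N + 1 + (2 * M + 1 + e))) /
      (qint (2 * M + 3 + e) * qint (2 * M + 4 + e))) := by
    simp only [hWdef, Finset.prod_range_succ, mul_assoc]
  have hW0 : W 0 = qint (N + 1) ^ e / (qint 2 * qint 3 ^ e) := by simp [hWdef]
  have hx (M : ℕ) : idp (qint N) (e : ZMod 2) (2 * ((M + 1 : ℕ) : ℤ) + e) =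
      qint N * qint (N + 1 - (2 * M + 1 + e)) * W M := by
    induction M with
    | zero =>
      rw [idp_first he, hW0]
      interval_cases e <;> simp <;> ring_nf
    | succ M ih =>
      rw [idp_add_two he, ih, hWs, qint_sq_sub_sq]
      push_cast
      rw [show N - (2 * (M : ℤ) + 2 + e) = N + 1 - (2 * (M + 1) + 1 + e) by ring,
        show N + (2 * (M : ℤ) + 2 + e) = N + 1 + (2 * M + 1 + e) by ring]
      ring
  have hy (M : ℕ) : idp (qint (N + 2)) (e : ZMod 2) (2 * ((M + 1 : ℕ) : ℤ) + e) =
      qint (N + 2) * qint (N + 1 + (2 * M + 1 + e)) * W M := by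
    induction M with
    | zero =>
      rw [idp_first he, hW0]
      interval_cases e <;> simp <;> ring_nf
    | succ M ih =>
      rw [idp_add_two he, ih, hWs, qint_sq_sub_sq]
      push_cast
      rw [show N + 2 - (2 * (M : ℤ) + 2 + e) = N + 1 - (2 * M + 1 + e) by ring,
        show N + 2 + (2 * (M : ℤ) + 2 + e) = N + 1 + (2 * (M + 1) + 1 + e) by ring]
      ring
  have key := alternating_sum_telescope hQ e N
    (fun m => idp (qint N) (e : ZMod 2) (2 * (m : ℤ) + e))
    (fun m => idp (qint (N + 2)) (e : ZMod 2) (2 * (m : ℤ) + e)) W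
    (fun M => by simpa only [hb] using hx M) (fun M => by simpa only [hb] using hy M)
    (fun M => by
      have h1 : qint (2 * M + 3 + e) ≠ 0 := qint_ne_zero (by omega)
      have h2 : qint (2 * M + 4 + e) ≠ 0 := qint_ne_zero (by omega)
      simp only [hb]
      rw [hWs]
      field_simp)
    (by
      have h2 : qint 2 ≠ 0 := qint_ne_zero (by norm_num)
      have h3 : qint 3 ≠ 0 := qint_ne_zero (by norm_num)
      simp only [hb]
      rw [hW0]
      interval_cases e
      · simp [idp_zero_zero, qint_one]
        field_simp
      · have h := bracket_add_two hQ N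
        simp only [hb] at h
        simp only [Nat.cast_one, Nat.cast_zero, mul_zero, zero_add, idp_one_one, h, pow_one,
          Int.reduceAdd]
        field_simp) d
  have hWd : W d = 0 := by
    simp only [hWdef]
    rw [Finset.prod_eq_zero (Finset.mem_range.2 had), mul_zero]
    rw [show N + 1 - (2 * (a : ℤ) + 1 + e) = 0 by rw [hN]; ring]
    simp [qint_zero]
  rw [hWd, mul_zero, zero_mul] at key
  simp only [mul_add, Finset.sum_add_distrib] at key
  rw [neg_mul, ← add_eq_zero_iff_eq_neg, ← key]
  simp only [braidSum, smul_eq_mul, Finset.mul_sum]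
  congr 1
  exact Finset.sum_congr rfl fun m _ => by ring_nf

lemma idp_qint_self {e : ℕ} (he : e < 2) (M : ℕ) :
    idp (qint e) (e : ZMod 2) (2 * ((M + 1 : ℕ) : ℤ) + e) = 0 := by
  induction M with
  | zero => rw [idp_first he]; interval_cases e <;> simp [qint_zero]
  | succ M ih => rw [idp_add_two he, ih]; simp

lemma braidSum_qint_self (Q : F) {e : ℕ} (he : e < 2) (d : ℕ) :
    braidSum Q e d (qint e) = 1 := by
  rw [braidSum, Finset.sum_range_succ', Finset.sum_eq_zero]
  · interval_cases e
    · simp [idp_zero_zero]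
    · simp [idp_one_one, qint_one]
  · intro m _
    rw [idp_qint_self he, smul_zero]

lemma braidSum_neg (Q : F) {e : ℕ} (he : e < 2) (d : ℕ) (l : F) :
    braidSum Q e d (-l) = (-1) ^ e * braidSum Q e d l := by
  simp only [braidSum, Finset.mul_sum]
  refine Finset.sum_congr rfl fun m _ => ?_
  interval_cases e
  · rcases m with _ | m
    · simp [idp_zero_zero]
    · simp only [Nat.cast_zero, add_zero, idp_zero_even]
      simp
  · simp only [Nat.cast_one, idp_one_odd]
    simp

lemma bracket_X_inv (k : ℤ) : bracket (RatFunc.X : F)⁻¹ k = qint k := by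
  rw [bracket_inv, qint_eq_bracket]

lemma braidSum_mul_braidSum_inv_nat {e : ℕ} (he : e < 2) {a d : ℕ} (had : a ≤ d) :
    braidSum (RatFunc.X : F) e d (qint (2 * a + e)) *
      braidSum (RatFunc.X : F)⁻¹ e d (qint (2 * a + e)) = 1 := by
  induction a with
  | zero => simp [braidSum_qint_self _ he]
  | succ a ih =>
    have hX : (RatFunc.X : F) ≠ 0 := RatFunc.X_ne_zero
    have h := ih (by omega)
    push_cast
    rw [show 2 * ((a : ℤ) + 1) + e = 2 * a + e + 2 by ring,
      braidSum_qint_add_two hX (fun k => (qint_eq_bracket k).symm) he had,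
      braidSum_qint_add_two (inv_ne_zero hX) bracket_X_inv he had, inv_zpow]
    have hz := zpow_ne_zero (-2 * (2 * (a : ℤ) + e + 1)) hX
    rw [mul_mul_mul_comm, neg_mul_neg, mul_inv_cancel₀ hz, one_mul, h]

lemma braidSum_mul_braidSum_inv {n k : ℕ} (hk : k ≤ n) :
    braidSum (RatFunc.X : F) (n % 2) (n / 2) (qint (n - 2 * k)) *
      braidSum (RatFunc.X : F)⁻¹ (n % 2) (n / 2) (qint (n - 2 * k)) = 1 := by
  have he : n % 2 < 2 := Nat.mod_lt _ two_pos
  rcases le_total k (n / 2) with h | h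
  · rw [show (n : ℤ) - 2 * k = 2 * ((n / 2 - k : ℕ) : ℤ) + (n % 2 : ℕ) by omega]
    exact braidSum_mul_braidSum_inv_nat he (by omega)
  · rcases eq_or_lt_of_le h with h' | h'
    · rw [show (n : ℤ) - 2 * k = 2 * ((0 : ℕ) : ℤ) + (n % 2 : ℕ) by omega]
      exact braidSum_mul_braidSum_inv_nat he (by omega)
    · rw [show (n : ℤ) - 2 * k = -(2 * ((k - n / 2 - n % 2 : ℕ) : ℤ) + (n % 2 : ℕ)) by omega,
        qint_neg, braidSum_neg _ he, braidSum_neg _ he, mul_mul_mul_comm, ← mul_pow,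
        braidSum_mul_braidSum_inv_nat he (by omega)]
      simp


section LeftEigenvectors

open Polynomial

/-- The product `∏_{i<a} (1 + s t^i x)`. -/
def qPochPoly {K : Type*} [Field K] (s t : K) (a : ℕ) : K[X] :=
  ∏ i ∈ Finset.range a, (1 + C (s * t ^ i) * X)

lemma qPochPoly_comp {K : Type*} [Field K] (s t : K) (a : ℕ) :
    (qPochPoly s t a).comp (C t * X) * (1 + C s * X) =
      qPochPoly s t a * (1 + C (s * t ^ a) * X) := by
  induction a with
  | zero => simp [qPochPoly]
  | succ a ih =>
    have h : qPochPoly s t (a + 1) = qPochPoly s t a * (1 + C (s * t ^ a) * X) :=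
      Finset.prod_range_succ _ _
    rw [h, mul_comp, mul_right_comm, ih]
    simp only [add_comp, mul_comp, one_comp, C_comp, X_comp, C_mul, pow_succ]
    ring

lemma natDegree_qPochPoly_le {K : Type*} [Field K] (s t : K) (a : ℕ) :
    (qPochPoly s t a).natDegree ≤ a := by
  refine (natDegree_prod_le _ _).trans ?_
  refine (Finset.sum_le_card_nsmul _ _ 1 fun i _ => ?_).trans (by simp)
  compute_degree

lemma coeff_zero_qPochPoly {K : Type*} [Field K] (s t : K) (a : ℕ) :
    (qPochPoly s t a).coeff 0 = 1 := by
  simp [qPochPoly, coeff_zero_eq_eval_zero, eval_prod]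

/-- Generating polynomial of the (rescaled) left eigenvector of `B` on `L(a + b)` with
eigenvalue `[a - b]`. -/
def eigenPoly (a b : ℕ) : F[X] :=
  qPochPoly (qz (1 - (a + b))) (qz 2) a * qPochPoly (-qz (1 - (a + b))) (qz 2) b

lemma coeff_eigenPoly_of_lt {a b k : ℕ} (h : a + b < k) : (eigenPoly a b).coeff k = 0 := by
  refine coeff_eq_zero_of_natDegree_lt (lt_of_le_of_lt ?_ h)
  exact natDegree_mul_le.trans
    (add_le_add (natDegree_qPochPoly_le _ _ _) (natDegree_qPochPoly_le _ _ _))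

lemma coeff_zero_eigenPoly (a b : ℕ) : (eigenPoly a b).coeff 0 = 1 := by
  simp [eigenPoly, mul_coeff_zero, coeff_zero_qPochPoly]

lemma qz_pow (a : ℤ) (k : ℕ) : qz a ^ k = qz (a * k) := by
  simp only [qz]; rw [zpow_mul, zpow_natCast]

lemma eigenPoly_comp (a b : ℕ) :
    (eigenPoly a b).comp (C (qz 2) * X) * (1 - C (qz (2 - 2 * (a + b))) * X ^ 2) =
      eigenPoly a b * (1 + C (qz (1 + a - b) - qz (1 + b - a)) * X - C (qz 2) * X ^ 2) := by
  have h1 := qPochPoly_comp (qz (1 - (a + b))) (qz 2) a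
  have h2 := qPochPoly_comp (-qz (1 - (a + b))) (qz 2) b
  rw [qz_pow, ← qz_add] at h1
  rw [qz_pow, neg_mul, ← qz_add] at h2
  rw [show 1 - ((a : ℤ) + b) + 2 * a = 1 + a - b by ring] at h1
  rw [show 1 - ((a : ℤ) + b) + 2 * b = 1 + b - a by ring] at h2
  have e1 : qz (2 - 2 * (a + b)) = qz (1 - (a + b)) * qz (1 - (a + b)) := by
    rw [← qz_add]; congr 1; ring
  have e2 : qz 2 = qz (1 + a - b) * qz (1 + b - a) := by
    rw [← qz_add]; congr 1; ring
  have hl : (1 - C (qz (2 - 2 * (a + b))) * X ^ 2 : F[X]) =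
      (1 + C (qz (1 - (a + b))) * X) * (1 + C (-qz (1 - (a + b))) * X) := by
    rw [e1]; simp only [C_mul, C_neg]; ring
  have hr : (1 + C (qz (1 + a - b) - qz (1 + b - a)) * X - C (qz 2) * X ^ 2 : F[X]) =
      (1 + C (qz (1 + a - b)) * X) * (1 + C (-qz (1 + b - a)) * X) := by
    rw [e2]; simp only [C_mul, C_neg, C_sub]; ring
  rw [hl, hr, eigenPoly, mul_comp, mul_mul_mul_comm, h1, h2, mul_mul_mul_comm]

lemma eigenPoly_comp_expanded (a b : ℕ) :
    (eigenPoly a b).comp (C (qz 2) * X) -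
        C (qz (2 - 2 * (a + b))) * ((eigenPoly a b).comp (C (qz 2) * X) * X ^ 2) =
      eigenPoly a b + C (qz (1 + a - b) - qz (1 + b - a)) * (eigenPoly a b * X) -
        C (qz 2) * (eigenPoly a b * X ^ 2) := by
  linear_combination eigenPoly_comp a b

lemma coeff_eigenPoly_one (a b : ℕ) :
    qz 2 * (eigenPoly a b).coeff 1 =
      (eigenPoly a b).coeff 1 + (qz (1 + a - b) - qz (1 + b - a)) := by
  have h := congrArg (fun p => coeff p (0 + 1)) (eigenPoly_comp_expanded a b)
  simp only [coeff_sub, coeff_add, coeff_C_mul, coeff_mul_X, coeff_mul_X_pow',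
    comp_C_mul_X_coeff, coeff_zero_eigenPoly] at h
  norm_num at h
  linear_combination h

lemma coeff_eigenPoly_add_two (a b k : ℕ) :
    qz (2 * (k + 2)) * (eigenPoly a b).coeff (k + 2) -
        qz (2 - 2 * (a + b) + 2 * k) * (eigenPoly a b).coeff k =
      (eigenPoly a b).coeff (k + 2) +
        (qz (1 + a - b) - qz (1 + b - a)) * (eigenPoly a b).coeff (k + 1) -
        qz 2 * (eigenPoly a b).coeff k := by
  have h := congrArg (fun p => coeff p (k + 2)) (eigenPoly_comp_expanded a b)
  simp only [coeff_sub, coeff_add, coeff_C_mul, coeff_mul_X_pow, comp_C_mul_X_coeff,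
    show coeff (eigenPoly a b * X) (k + 2) = coeff (eigenPoly a b) (k + 1) from coeff_mul_X _ _,
    qz_pow] at h
  rw [qz_add]
  push_cast at h
  linear_combination h

/-- Coordinates of the left eigenvector of `B` on `L(a + b)` with eigenvalue `[a - b]`. -/
def eigenCoord (a b k : ℕ) : F := qz (k.choose 2) * (eigenPoly a b).coeff k

lemma eigenCoord_zero (a b : ℕ) : eigenCoord a b 0 = 1 := by
  simp [eigenCoord, coeff_zero_eigenPoly, qz_zero]

lemma eigenCoord_of_lt {a b k : ℕ} (h : a + b < k) : eigenCoord a b k = 0 := by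
  rw [eigenCoord, coeff_eigenPoly_of_lt h, mul_zero]

lemma qint_mul_eigenCoord_one (a b : ℕ) :
    qint 1 * eigenCoord a b 1 = qint (a - b) * eigenCoord a b 0 := by
  have h := coeff_eigenPoly_one a b
  have e1 : qz (1 + a - b) = qz 1 * qz (a - b) := by rw [← qz_add]; congr 1; ring
  have e2 : qz (1 + b - a) = qz 1 * qz (-(a - b)) := by rw [← qz_add]; congr 1; ring
  have e3 : qz 2 = qz 1 * qz 1 := by rw [← qz_add]; rfl
  have e4 : qz 1 * qz (-1) = 1 := by rw [← qz_add]; exact qz_zero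
  rw [e1, e2, e3] at h
  rw [eigenCoord_zero, qint_one, eigenCoord]
  simp only [Nat.choose_succ_self, Nat.cast_zero, qz_zero, one_mul, mul_one, qint]
  rw [eq_div_iff qz_sub_ne_zero]
  apply mul_left_cancel₀ (qz_ne_zero 1)
  linear_combination h - (eigenPoly a b).coeff 1 * e4

lemma qint_mul_eigenCoord_add_two (a b k : ℕ) :
    qint (k + 2) * eigenCoord a b (k + 2) +
        qz (2 * k + 1 - (a + b)) * qint (a + b - k) * eigenCoord a b k =
      qint (a - b) * eigenCoord a b (k + 1) := by
  have h := coeff_eigenPoly_add_two a b k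
  have c1 : (k + 1).choose 2 = k.choose 2 + k := by
    rw [Nat.choose_succ_succ' k 1, Nat.choose_one_right, add_comm]
  have c2 : (k + 2).choose 2 = k.choose 2 + k + (k + 1) := by
    rw [Nat.choose_succ_succ' (k + 1) 1, Nat.choose_one_right, c1, add_comm]
  simp only [eigenCoord, qint, c1, c2, div_mul_eq_mul_div, mul_div_assoc', ← add_div]
  congr 1
  push_cast
  have e1 : qz (k.choose 2) * qz (k - 1) * qz (2 * (k + 2)) =
      qz (k + 2) * qz (k.choose 2 + k + (k + 1)) := by
    simp only [← qz_add]; congr 1; ring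
  have e2 : qz (k.choose 2) * qz (k - 1) = qz (-(k + 2)) * qz (k.choose 2 + k + (k + 1)) := by
    simp only [← qz_add]; congr 1; ring
  have e3 : qz (k.choose 2) * qz (k - 1) * qz (2 - 2 * (a + b) + 2 * k) =
      qz (2 * k + 1 - (a + b)) * qz (-(a + b - k)) * qz (k.choose 2) := by
    simp only [← qz_add]; congr 1; ring
  have e4 : qz (k.choose 2) * qz (k - 1) * qz 2 =
      qz (2 * k + 1 - (a + b)) * qz (a + b - k) * qz (k.choose 2) := by
    simp only [← qz_add]; congr 1; ring
  have e5 : qz (k.choose 2) * qz (k - 1) * qz (1 + a - b) =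
      qz (a - b) * qz (k.choose 2 + k) := by
    simp only [← qz_add]; congr 1; ring
  have e6 : qz (k.choose 2) * qz (k - 1) * qz (1 + b - a) =
      qz (-(a - b)) * qz (k.choose 2 + k) := by
    simp only [← qz_add]; congr 1; ring
  linear_combination qz (k.choose 2) * qz (k - 1) * h -
    (eigenPoly a b).coeff (k + 2) * (e1 - e2) + (eigenPoly a b).coeff k * (e3 - e4) +
    (eigenPoly a b).coeff (k + 1) * (e5 - e6)

end LeftEigenvectors

/-- The matrix of `B` in the basis `v₀, …, v_n`. -/
def Bmat (n : ℕ) : Matrix (Fin (n + 1)) (Fin (n + 1)) F :=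
  Matrix.of fun i j =>
    (if (i : ℕ) = (j : ℕ) + 1 then qint ((j : ℕ) + 1) else 0) +
      (if (i : ℕ) + 1 = (j : ℕ) then
        qz (2 * (j : ℕ) - 1 - n) * qint ((n : ℤ) + 1 - (j : ℕ)) else 0)

lemma Bop_eq_toLin' (n : ℕ) : Bop n = Matrix.toLin' (Bmat n) := by
  rw [Bop, Fop, Eop, Kinvop, Module.End.mul_eq_comp, ← Matrix.toLin'_mul, ← map_smul, ← map_add]
  congr 1
  ext i j
  simp only [Bmat, Matrix.add_apply, Matrix.smul_apply, Matrix.mul_apply, Matrix.of_apply,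
    mul_ite, mul_zero, Finset.sum_ite_eq', Finset.mem_univ, if_true, smul_eq_mul, ite_mul, zero_mul]
  congr 1
  split_ifs with h
  · rw [mul_comm (qint _), ← mul_assoc, ← qz_add]
    congr 2
    ring
  · rfl

lemma sum_ite_val_eq {n : ℕ} (m : ℕ) (f : ℕ → F) (c : F) :
    ∑ i : Fin (n + 1), (if (i : ℕ) = m then c else 0) * f i = if m < n + 1 then c * f m else 0 := by
  rw [Fin.sum_univ_eq_sum_range (fun i => (if i = m then c else 0) * f i)]
  simp [Finset.sum_ite_eq']

lemma Bmat_transpose_mulVec (a b : ℕ) :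
    (Bmat (a + b)).transpose.mulVec (fun i => eigenCoord a b i) =
      qint (a - b) • fun i : Fin (a + b + 1) => eigenCoord a b i := by
  ext ⟨j, hj⟩
  simp only [Matrix.mulVec, dotProduct, Matrix.transpose_apply, Bmat, Matrix.of_apply, add_mul,
    Finset.sum_add_distrib, Pi.smul_apply, smul_eq_mul, sum_ite_val_eq]
  have h1 : (if j + 1 < a + b + 1 then qint (j + 1) * eigenCoord a b (j + 1) else 0) =
      qint (j + 1) * eigenCoord a b (j + 1) := by
    split_ifs with h
    · rfl
    · rw [eigenCoord_of_lt (by omega), mul_zero]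
  rw [h1]
  rcases j with _ | k
  · simpa using qint_mul_eigenCoord_one a b
  · simp only [Nat.add_right_cancel_iff, sum_ite_val_eq]
    rw [if_pos (by omega), ← qint_mul_eigenCoord_add_two]
    push_cast
    ring_nf

lemma aeval_Bop_eq_zero {n : ℕ} {P : Polynomial F}
    (hP : ∀ k ≤ n, P.eval (qint (n - 2 * k)) = 0) : Polynomial.aeval (Bop n) P = 0 := by
  set T : Module.End F (V n) := Matrix.toLin' (Bmat n).transpose with hT
  let v : Fin (n + 1) → V n := fun k i => eigenCoord (n - k) k i
  let μ : Fin (n + 1) → F := fun k => qint (n - 2 * (k : ℕ))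
  have hμ : Function.Injective μ := fun x y h => by
    have := qint_injective h
    exact Fin.ext (by omega)
  have hv (k : Fin (n + 1)) : T.HasEigenvector (μ k) (v k) := by
    rw [Module.End.hasEigenvector_iff, Module.End.mem_eigenspace_iff]
    constructor
    · obtain ⟨k, hk⟩ := k
      obtain ⟨a, rfl⟩ : ∃ a, n = a + k := ⟨n - k, by omega⟩
      have h := Bmat_transpose_mulVec a k
      rw [hT, Matrix.toLin'_apply]
      simp only [v, μ, Nat.add_sub_cancel]
      rw [h]
      congr 2
      push_cast
      ring
    · intro h
      have h0 := congrFun h 0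
      simp [v, eigenCoord_zero] at h0
  have hli := Module.End.eigenvectors_linearIndependent' T μ hμ v hv
  have hspan := hli.span_eq_top_of_card_eq_finrank (by simp)
  have hTP : Polynomial.aeval T P = 0 := by
    refine LinearMap.ext_on_range hspan fun k => ?_
    rw [Module.End.aeval_apply_of_hasEigenvector (hv k), hP k (by omega), zero_smul,
      LinearMap.zero_apply]
  have hmat (A : Matrix (Fin (n + 1)) (Fin (n + 1)) F) :
      Polynomial.aeval (Matrix.toLin' A) P = Matrix.toLin' (Polynomial.aeval A P) :=
    Polynomial.aeval_algHom_apply Matrix.toLinAlgEquiv'.toAlgHom A P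
  rw [hT, hmat, LinearEquiv.map_eq_zero_iff] at hTP
  rw [Bop_eq_toLin', hmat, LinearEquiv.map_eq_zero_iff]
  have htr : Polynomial.aeval (Bmat n).transpose P = (Polynomial.aeval (Bmat n) P).transpose := by
    simp [Polynomial.aeval_eq_sum_range, Matrix.transpose_sum]
  rw [htr] at hTP
  simpa using hTP

lemma braidSum_Bop_mul (n : ℕ) :
    braidSum (RatFunc.X : F) (n % 2) (n / 2) (Bop n) *
      braidSum (RatFunc.X : F)⁻¹ (n % 2) (n / 2) (Bop n) = 1 := by
  let f (Q : F) : Polynomial F := braidSum Q (n % 2) (n / 2) Polynomial.X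
  have hf (Q : F) {A : Type} [Ring A] [Algebra F A] (x : A) :
      Polynomial.aeval x (f Q) = braidSum Q (n % 2) (n / 2) x := by
    simp only [f, map_braidSum, Polynomial.aeval_X]
  have h := aeval_Bop_eq_zero (n := n) (P := f RatFunc.X * f RatFunc.X⁻¹ - 1) fun k hk => by
    rw [← Polynomial.coe_aeval_eq_eval, map_sub, map_mul, hf, hf, braidSum_mul_braidSum_inv hk]
    simp
  rw [map_sub, map_mul, hf, hf, map_one, sub_eq_zero] at h
  exact h

end Lnmod


/-- Integral braid operators in split rank one (from §7.2 of the paper): on `L(n)` with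
`p = n mod 2`, the operators
`T' = Σ_{2m+p ≤ n} (−1)^m q^{−m} B^{(2m+p)}_{p̄}` and
`T'' = Σ_{2m+p ≤ n} (−1)^m q^{m} B^{(2m+p)}_{p̄}` are mutually inverse. -/
theorem statement12 (n : ℕ) :
    (∑ m ∈ Finset.range (n / 2 + 1),
        ((-1 : F) ^ m * qz (-(m : ℤ))) •
          idp (Bop n) ((n : ℕ) : ZMod 2) (2 * (m : ℤ) + ((n % 2 : ℕ) : ℤ))) *
      (∑ m ∈ Finset.range (n / 2 + 1),
        ((-1 : F) ^ m * qz (m : ℤ)) •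
          idp (Bop n) ((n : ℕ) : ZMod 2) (2 * (m : ℤ) + ((n % 2 : ℕ) : ℤ))) = 1
    ∧
    (∑ m ∈ Finset.range (n / 2 + 1),
        ((-1 : F) ^ m * qz (m : ℤ)) •
          idp (Bop n) ((n : ℕ) : ZMod 2) (2 * (m : ℤ) + ((n % 2 : ℕ) : ℤ))) *
      (∑ m ∈ Finset.range (n / 2 + 1),
        ((-1 : F) ^ m * qz (-(m : ℤ))) •
          idp (Bop n) ((n : ℕ) : ZMod 2) (2 * (m : ℤ) + ((n % 2 : ℕ) : ℤ))) = 1 := by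
  have hcast : ((n : ℕ) : ZMod 2) = ((n % 2 : ℕ) : ZMod 2) := (ZMod.natCast_mod n 2).symm
  have h1 : ∀ m : ℕ, qz (-(m : ℤ)) = (RatFunc.X : F) ^ (-(m : ℤ)) := fun _ => rfl
  have h2 : ∀ m : ℕ, qz (m : ℤ) = (RatFunc.X : F)⁻¹ ^ (-(m : ℤ)) := fun m => by simp [qz]
  have h := braidSum_Bop_mul n
  simp only [h1, h2, hcast]
  exact ⟨h, mul_eq_one_comm.1 h⟩
end
end

section
/- With notation as in the context (an algebra A over ℚ(q) with elements B, C and invertible K satisfying KB = q^{−2}BK and KC = q²CK, integers N₁, N₂ ≥ 0, and a family b(m₁,m₂) satisfying the two stated recursions and vanishing outside the box 0 ≤ m₁ ≤ N₁, 0 ≤ m₂ ≤ N₂), the following identity holds in A for every integer ℓ ≥ 0: b(N₁,N₂) · B^{(ℓ)} = Σ_{x=0}^{ℓ} q^{(ℓ−x)(N₁−x) − x²} · B^{(ℓ−x)} · b(N₁, N₂−x) · K^{x}. -/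
noncomputable section

namespace DiagRk2

/-- The base field `F = ℚ(q)`. -/
abbrev F : Type := RatFunc ℚ

/-- `q^e` for `e : ℤ`. -/
def qz (e : ℤ) : F := (RatFunc.X : F) ^ e

/-- The quantum integer `[n]`. -/
def qint (n : ℤ) : F := (qz n - qz (-n)) / (qz 1 - qz (-1))

/-- The quantum factorial `[n]!`. -/
def qfact (n : ℕ) : F := ∏ i ∈ Finset.range n, qint ((i : ℤ) + 1)

/-- The balanced Gaussian binomial `⌊a ¦ k⌋ = ∏_{s=1}^{k}(q^{a−s+1}−q^{−a+s−1})/(q^s−q^{−s})`. -/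
def qbinom (a : ℤ) (k : ℕ) : F :=
  ∏ s ∈ Finset.range k,
    (qz (a - s) - qz (-(a - s))) / (qz ((s : ℤ) + 1) - qz (-((s : ℤ) + 1)))

variable {A : Type*} [Ring A] [Algebra F A]

/-- Divided power `x^{(m)} = x^m/[m]!` for `m ≥ 0`, and `0` for `m < 0`. -/
def dp (x : A) (m : ℤ) : A := if 0 ≤ m then (qfact m.toNat)⁻¹ • x ^ m.toNat else 0

end DiagRk2

open DiagRk2

namespace DiagRk2

theorem qz_add (a b : ℤ) : qz (a + b) = qz a * qz b :=
  zpow_add₀ RatFunc.X_ne_zero a b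

theorem qz_zero : qz 0 = 1 := zpow_zero _

theorem qint_add (a b : ℤ) : qint (a + b) = qz (-b) * qint a + qz a * qint b := by
  unfold qint
  rw [neg_add, qz_add, qz_add]
  ring

theorem qz_natCast_ne_one (n : ℕ) (hn : n ≠ 0) : qz n ≠ 1 := by
  intro h
  have h' : algebraMap (Polynomial ℚ) (RatFunc ℚ) (Polynomial.X ^ n)
      = algebraMap (Polynomial ℚ) (RatFunc ℚ) 1 := by
    rw [map_pow, RatFunc.algebraMap_X, map_one, ← zpow_natCast]
    exact h
  have h'' := congrArg Polynomial.natDegree (RatFunc.algebraMap_injective ℚ h')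
  simp only [Polynomial.natDegree_X_pow, Polynomial.natDegree_one] at h''
  exact hn h''

theorem qz_sub_qz_neg_ne_zero (n : ℕ) : qz ((n : ℤ) + 1) - qz (-((n : ℤ) + 1)) ≠ 0 := by
  intro h
  apply qz_natCast_ne_one (2 * (n + 1)) (by omega)
  have e : ((2 * (n + 1) : ℕ) : ℤ) = ((n : ℤ) + 1) + ((n : ℤ) + 1) := by push_cast; ring
  rw [e, qz_add]
  nth_rewrite 2 [sub_eq_zero.mp h]
  rw [← qz_add, add_neg_cancel, qz_zero]

theorem qint_succ_ne_zero (n : ℕ) : qint ((n : ℤ) + 1) ≠ 0 :=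
  div_ne_zero (qz_sub_qz_neg_ne_zero n) (by simpa using qz_sub_qz_neg_ne_zero 0)

theorem qfact_ne_zero (n : ℕ) : qfact n ≠ 0 :=
  Finset.prod_ne_zero_iff.mpr fun i _ => qint_succ_ne_zero i

theorem qint_zero : qint 0 = 0 := by simp [qint]

/-- The falling quantum factorial `[a][a-1]⋯[a-k+1]`. -/
def qdesc (a : ℤ) (k : ℕ) : F := ∏ i ∈ Finset.range k, qint (a - i)

theorem qdesc_succ (a : ℤ) (k : ℕ) : qdesc a (k + 1) = qdesc a k * qint (a - k) :=
  Finset.prod_range_succ _ _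

theorem qdesc_succ_succ (a : ℤ) (k : ℕ) :
    qdesc (a + 1) (k + 1) = qint (a + 1) * qdesc a k := by
  rw [qdesc, Finset.prod_range_succ', mul_comm, Nat.cast_zero, sub_zero]
  congr 1
  refine Finset.prod_congr rfl fun i _ => ?_
  congr 1
  push_cast
  ring

theorem qdesc_mul_qfact (n k : ℕ) : qdesc ((n + k : ℕ) : ℤ) k * qfact n = qfact (n + k) := by
  induction k with
  | zero => simp [qdesc]
  | succ k ih =>
    rw [← add_assoc, Nat.cast_succ, qdesc_succ_succ, mul_assoc, ih, qfact, qfact,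
      Finset.prod_range_succ, mul_comm]

/-- The coefficient of `B^(l-x) * c x * K^x` in the expansion of `c 0 * B^l`. -/
def expCoeff (N : ℤ) (l x : ℕ) : F :=
  qz (((l : ℤ) - x) * (N - x) - (x : ℤ) ^ 2) * qdesc l x

theorem expCoeff_succ_zero (N : ℤ) (l : ℕ) :
    expCoeff N (l + 1) 0 = expCoeff N l 0 * qz N := by
  simp only [expCoeff, qdesc, Finset.range_zero, Finset.prod_empty, mul_one]
  rw [← qz_add]
  congr 1
  push_cast
  ring

theorem expCoeff_self_succ (N : ℤ) (l : ℕ) : expCoeff N l (l + 1) = 0 := by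
  rw [expCoeff, qdesc_succ, sub_self, qint_zero, mul_zero, mul_zero]

theorem expCoeff_succ_succ (N : ℤ) (l x : ℕ) :
    expCoeff N (l + 1) (x + 1) = expCoeff N l (x + 1) * qz (N - 2 * (x + 1))
      + expCoeff N l x * (qz (-2 * x - 1) * qint (x + 1)) := by
  have h : qint ((l : ℤ) + 1)
      = qz (-((x : ℤ) + 1)) * qint ((l : ℤ) - x) + qz ((l : ℤ) - x) * qint (x + 1) := by
    rw [← qint_add]
    congr 1
    ring
  simp only [expCoeff, Nat.cast_add, Nat.cast_one]
  rw [qdesc_succ_succ, qdesc_succ, h]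
  have h1 : qz (((l : ℤ) + 1 - (x + 1)) * (N - (x + 1)) - ((x : ℤ) + 1) ^ 2)
        * qz (-((x : ℤ) + 1))
      = qz (((l : ℤ) - (x + 1)) * (N - (x + 1)) - ((x : ℤ) + 1) ^ 2)
        * qz (N - 2 * (x + 1)) := by
    rw [← qz_add, ← qz_add]
    congr 1
    ring
  have h2 : qz (((l : ℤ) + 1 - (x + 1)) * (N - (x + 1)) - ((x : ℤ) + 1) ^ 2)
        * qz ((l : ℤ) - x)
      = qz (((l : ℤ) - x) * (N - x) - (x : ℤ) ^ 2) * qz (-2 * x - 1) := by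
    rw [← qz_add, ← qz_add]
    congr 1
    ring
  linear_combination qdesc l x * qint ((l : ℤ) - x) * h1 + qdesc l x * qint (x + 1) * h2

section Expansion

variable {A : Type*} [Ring A] [Algebra F A]

theorem pow_mul_of_qcomm {K B : A} (hKB : K * B = qz (-2) • (B * K)) (x : ℕ) :
    K ^ x * B = qz (-2 * x) • (B * K ^ x) := by
  induction x with
  | zero => simp [qz_zero]
  | succ x ih =>
    rw [pow_succ', mul_assoc, ih, mul_smul_comm, ← mul_assoc, hKB, smul_mul_assoc, smul_smul,
      ← qz_add, mul_assoc]
    congr 2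
    push_cast
    ring

theorem mul_pow_eq_sum {K B : A} {N : ℤ} {c : ℕ → A}
    (hKB : K * B = qz (-2) • (B * K))
    (hc : ∀ x : ℕ, c x * B = qz N • (B * c x) + (qz (-1) * qint (x + 1)) • (c (x + 1) * K))
    (l : ℕ) :
    c 0 * B ^ l = ∑ x ∈ Finset.range (l + 1), expCoeff N l x • (B ^ (l - x) * c x * K ^ x) := by
  induction l with
  | zero => simp [expCoeff, qdesc, qz_zero]
  | succ l ih =>
    have hterm : ∀ x ∈ Finset.range (l + 1),
        expCoeff N l x • (B ^ (l - x) * c x * K ^ x) * B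
          = (expCoeff N l x * qz (N - 2 * x)) • (B ^ (l + 1 - x) * c x * K ^ x)
            + (expCoeff N l x * (qz (-2 * x - 1) * qint (x + 1))) •
              (B ^ (l - x) * c (x + 1) * K ^ (x + 1)) := by
      intro x hx
      have hx' : l + 1 - x = l - x + 1 := by
        have := Finset.mem_range.mp hx
        omega
      have e1 : qz (N - 2 * x) = qz (-2 * x) * qz N := by
        rw [← qz_add]
        congr 1
        ring
      have e2 : qz (-2 * x - 1) = qz (-2 * x) * qz (-1) := by
        rw [← qz_add]
        congr 1
      rw [hx', e1, e2, smul_mul_assoc, mul_assoc _ (K ^ x), pow_mul_of_qcomm hKB, mul_smul_comm,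
        mul_assoc _ (c x), ← mul_assoc (c x), hc, pow_succ B, pow_succ' K]
      simp only [add_mul, mul_add, smul_mul_assoc, mul_smul_comm, smul_add, smul_smul, mul_assoc]
    have hext : ∑ x ∈ Finset.range (l + 1),
          (expCoeff N l x * qz (N - 2 * x)) • (B ^ (l + 1 - x) * c x * K ^ x)
        = ∑ x ∈ Finset.range (l + 1 + 1),
          (expCoeff N l x * qz (N - 2 * x)) • (B ^ (l + 1 - x) * c x * K ^ x) := by
      rw [Finset.sum_range_succ _ (l + 1), expCoeff_self_succ, zero_mul, zero_smul, add_zero]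
    rw [pow_succ, ← mul_assoc, ih, Finset.sum_mul, Finset.sum_congr rfl hterm,
      Finset.sum_add_distrib, hext, Finset.sum_range_succ' _ (l + 1),
      Finset.sum_range_succ' _ (l + 1), expCoeff_succ_zero, add_right_comm,
      ← Finset.sum_add_distrib]
    congr 1
    · refine Finset.sum_congr rfl fun x _ => ?_
      rw [expCoeff_succ_succ, add_smul, Nat.add_sub_add_right, Nat.cast_succ]
    · simp

theorem dp_natCast (x : A) (n : ℕ) : dp x (n : ℤ) = (qfact n)⁻¹ • x ^ n := by
  simp [dp]

end Expansion

end DiagRk2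

/-- Lemma 5.7 (`lem:qsBBij`) of the paper: given `B, C` and an invertible `K` with
`KB = q^{−2}BK`, `KC = q²CK`, and a family `b(m₁,m₂)` vanishing outside
`0 ≤ m₁ ≤ N₁, 0 ≤ m₂ ≤ N₂` and satisfying the two stated recursions, for every `ℓ ≥ 0`:
`b(N₁,N₂)·B^{(ℓ)} = Σ_{x=0}^{ℓ} q^{(ℓ−x)(N₁−x)−x²}·B^{(ℓ−x)}·b(N₁,N₂−x)·K^x`. -/
theorem statement14 (A : Type*) [Ring A] [Algebra F A]
    (B C Kk Kk' : A)
    (hK : Kk * Kk' = 1) (hK' : Kk' * Kk = 1)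
    (hKB : Kk * B = qz (-2) • (B * Kk))
    (hKC : Kk * C = qz 2 • (C * Kk))
    (N1 N2 : ℕ) (b : ℤ → ℤ → A)
    (hvanish : ∀ m1 m2 : ℤ,
      (m1 < 0 ∨ (N1 : ℤ) < m1 ∨ m2 < 0 ∨ (N2 : ℤ) < m2) → b m1 m2 = 0)
    (hrecB : ∀ m1 m2 : ℤ,
      B * b m1 m2 - qz ((N1 : ℤ) - 2 * m1) • (b m1 m2 * B)
        = qint (m1 + 1) • b (m1 + 1) m2
          - (qz ((N1 : ℤ) - 2 * m1 - 1) * qint ((N2 : ℤ) - m2 + 1)) • (b m1 (m2 - 1) * Kk))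
    (hrecC : ∀ m1 m2 : ℤ,
      C * b m1 m2 - qz ((N2 : ℤ) - 2 * m2) • (b m1 m2 * C)
        = qint (m2 + 1) • b m1 (m2 + 1)
          - (qz ((N2 : ℤ) - 2 * m2 - 1) * qint ((N1 : ℤ) - m1 + 1)) • (b (m1 - 1) m2 * Kk'))
    (l : ℕ) :
    b (N1 : ℤ) (N2 : ℤ) * dp B (l : ℤ)
      = ∑ x ∈ Finset.range (l + 1),
          qz (((l : ℤ) - x) * ((N1 : ℤ) - x) - (x : ℤ) ^ 2) •
            (dp B ((l : ℤ) - x) * b (N1 : ℤ) ((N2 : ℤ) - x) * Kk ^ x) := by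
  have hc : ∀ x : ℕ, b N1 ((N2 : ℤ) - x) * B
      = qz N1 • (B * b N1 ((N2 : ℤ) - x))
        + (qz (-1) * qint (x + 1)) • (b N1 ((N2 : ℤ) - (x + 1 : ℕ)) * Kk) := by
    intro x
    have h := hrecB N1 ((N2 : ℤ) - x)
    rw [hvanish (N1 + 1) _ (by omega), smul_zero, zero_sub] at h
    have e1 : (N1 : ℤ) - 2 * N1 = -N1 := by ring
    have e2 : (N2 : ℤ) - (N2 - x) + 1 = x + 1 := by ring
    have e3 : (N2 : ℤ) - x - 1 = N2 - (x + 1 : ℕ) := by push_cast; ring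
    have e4 : qz N1 * qz (-N1) = 1 := by rw [← qz_add, add_neg_cancel, qz_zero]
    have e5 : qz N1 * (qz (-N1 - 1) * qint (x + 1)) = qz (-1) * qint (x + 1) := by
      rw [← mul_assoc, ← qz_add]
      congr 2
      ring
    rw [e1, e2, e3] at h
    have h' := congrArg (qz N1 • ·) h
    simp only [smul_sub, smul_neg, smul_smul, e4, e5, one_smul] at h'
    rw [← sub_eq_iff_eq_add', ← neg_inj, neg_sub]
    exact h'
  have key := mul_pow_eq_sum (c := fun x : ℕ => b N1 ((N2 : ℤ) - x)) hKB hc l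
  simp only [Nat.cast_zero, sub_zero] at key
  rw [dp_natCast, mul_smul_comm, key, Finset.smul_sum]
  refine Finset.sum_congr rfl fun x hx => ?_
  obtain ⟨n, rfl⟩ := Nat.exists_eq_add_of_le' (Nat.lt_succ_iff.mp (Finset.mem_range.mp hx))
  have e : ((n + x : ℕ) : ℤ) - x = n := by push_cast; ring
  rw [e, dp_natCast, Nat.add_sub_cancel, smul_mul_assoc, smul_mul_assoc, smul_smul, smul_smul,
    expCoeff, e, ← qdesc_mul_qfact]
  congr 1
  have hne : qdesc ((n + x : ℕ) : ℤ) x ≠ 0 := fun h0 =>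
    qfact_ne_zero (n + x) (by rw [← qdesc_mul_qfact, h0, zero_mul])
  have hn := qfact_ne_zero n
  field_simp
end
end

section
/- Let U be the presented quantum group of the context, associated to a symmetrizable generalized Cartan matrix (c_{kl})_{k,l=1,2,3} with c₁₂ = c₂₁ = −1. Then for all a, b, c ∈ ℕ, if c > −c₁₃, or b − c > −c₂₃, or a + c > −c₁₃ − c₂₃, then ad(E₁)^{(a)} ( ad(E₂)^{(b)} ( ad(E₁)^{(c)} (E₃) ) ) = 0 in U. -/
noncomputable section

namespace Serre3

/-- The base field `F = ℚ(q)`. -/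
abbrev F : Type := RatFunc ℚ

/-- `q^e` for `e : ℤ`. -/
def qz (e : ℤ) : F := (RatFunc.X : F) ^ e

/-- The quantum integer `[m]_k` for `q_k = q^{d}`. -/
def qintd (d : ℕ) (m : ℤ) : F := (qz (d * m) - qz (-(d * m))) / (qz (d : ℤ) - qz (-(d : ℤ)))

/-- The quantum factorial `[m]_k!` for `q_k = q^{d}`. -/
def qfactd (d : ℕ) (m : ℕ) : F := ∏ i ∈ Finset.range m, qintd d ((i : ℤ) + 1)

variable {A : Type*} [Ring A] [Algebra F A]

/-- Divided power `x^{(m)} = x^m/[m]_k!` with respect to `q_k = q^d`. -/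
def dpd (d : ℕ) (x : A) (m : ℕ) : A := (qfactd d m)⁻¹ • x ^ m

/-- The adjoint action `ad(E_k)(x) = E_k x − K_k x K_k⁻¹ E_k`. -/
def adE (e kk kk' : A) (x : A) : A := e * x - kk * x * kk' * e

/-- The divided power `ad(E_k)^{(a)} = ad(E_k)^a / [a]_k!`. -/
def adEdp (d : ℕ) (e kk kk' : A) (a : ℕ) (x : A) : A :=
  (qfactd d a)⁻¹ • ((adE e kk kk')^[a] x)

end Serre3

open Serre3

namespace Serre3

section Scalars

lemma X_pow_ne_one {n : ℕ} (hn : 0 < n) : (RatFunc.X : F) ^ n ≠ 1 := by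
  intro h
  have h2 : (Polynomial.X : Polynomial ℚ) ^ n = 1 := by
    apply RatFunc.algebraMap_injective ℚ
    simpa using h
  have h3 := congrArg Polynomial.natDegree h2
  simp at h3
  omega

lemma qz_ne_zero (e : ℤ) : qz e ≠ 0 := zpow_ne_zero _ RatFunc.X_ne_zero

lemma qz_add (e f : ℤ) : qz (e + f) = qz e * qz f := zpow_add₀ RatFunc.X_ne_zero _ _

lemma qz_zero : qz 0 = 1 := zpow_zero _

lemma qz_neg (e : ℤ) : qz (-e) = (qz e)⁻¹ := zpow_neg _ _

lemma qz_sub_qz_neg_ne_zero {e : ℤ} (he : 0 < e) : qz e - qz (-e) ≠ 0 := by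
  intro h
  obtain ⟨n, rfl⟩ := Int.eq_ofNat_of_zero_le he.le
  have h1 : qz ((n : ℤ) + n) = 1 := by
    rw [qz_add]
    nth_rewrite 2 [sub_eq_zero.mp h]
    rw [← qz_add, add_neg_cancel, qz_zero]
  refine X_pow_ne_one (n := n + n) (by omega) ?_
  rw [← h1, qz, ← zpow_natCast]
  push_cast
  rfl

lemma qintd_ne_zero {d : ℕ} (hd : 0 < d) {m : ℤ} (hm : 0 < m) : qintd d m ≠ 0 :=
  div_ne_zero (qz_sub_qz_neg_ne_zero (by positivity)) (qz_sub_qz_neg_ne_zero (by positivity))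

lemma qintd_zero (d : ℕ) : qintd d 0 = 0 := by simp [qintd]

lemma qintd_one {d : ℕ} (hd : 0 < d) : qintd d 1 = 1 := by
  rw [qintd, mul_one, div_self (qz_sub_qz_neg_ne_zero (by positivity))]

lemma qintd_two {d : ℕ} (hd : 0 < d) : qintd d 2 = qz d + qz (-d) := by
  rw [qintd, div_eq_iff (qz_sub_qz_neg_ne_zero (by positivity))]
  simp only [mul_sub, add_mul, ← qz_add]
  ring_nf

lemma qintd_add_two {d : ℕ} (hd : 0 < d) (m : ℤ) :
    qintd d (m + 2) = qintd d 2 * qintd d (m + 1) - qintd d m := by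
  have h := qz_sub_qz_neg_ne_zero (e := d) (by positivity)
  rw [qintd_two hd]
  simp only [qintd]
  rw [mul_div_assoc', ← sub_div]
  congr 1
  simp only [mul_sub, add_mul, ← qz_add]
  ring_nf

/-- The `q`-Pascal rule `[n - r] + qⁿ [r] = q^r [n]`. -/
lemma qintd_pascal (d : ℕ) (n r : ℤ) :
    qintd d (n - r) + qz (d * n) * qintd d r = qz (d * r) * qintd d n := by
  simp only [qintd]
  rw [mul_div_assoc', mul_div_assoc', ← add_div]
  congr 1
  simp only [mul_sub, ← qz_add]
  ring_nf

lemma qfactd_succ (d m : ℕ) : qfactd d (m + 1) = qfactd d m * qintd d ((m : ℤ) + 1) := by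
  rw [qfactd, Finset.prod_range_succ, ← qfactd]

lemma qfactd_ne_zero {d : ℕ} (hd : 0 < d) (m : ℕ) : qfactd d m ≠ 0 :=
  Finset.prod_ne_zero_iff.mpr fun _ _ => qintd_ne_zero hd (by positivity)

end Scalars

section QuantumSerre

variable {R : Type*} [Ring R] [Algebra F R] {d : ℕ}

/-- The quadratic quantum Serre relation `e² f - [2] e f e + f e² = 0`. -/
def IsQSerre (d : ℕ) (e f : R) : Prop :=
  e * e * f - qintd d 2 • (e * f * e) + f * e * e = 0

namespace IsQSerre

variable {e f : R}

lemma pow_mul_right (hd : 0 < d) (h : IsQSerre d e f) (p : ℕ) :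
    e ^ (p + 1) * f =
      qintd d ((p : ℤ) + 1) • (e * f * e ^ p) - qintd d p • (f * e ^ (p + 1)) := by
  induction p with
  | zero => simp [qintd_one hd, qintd_zero]
  | succ p ih =>
    have h' : e * e * f = qintd d 2 • (e * f * e) - f * e * e := by
      rw [eq_sub_iff_add_eq, ← sub_eq_zero, ← h]
      abel
    have h2 := qintd_add_two hd (p : ℤ)
    rw [pow_succ', mul_assoc, ih, mul_sub, mul_smul_comm, mul_smul_comm, ← mul_assoc,
      ← mul_assoc, h']
    push_cast
    rw [show (p : ℤ) + 1 + 1 = p + 2 by ring, h2]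
    simp only [sub_mul, smul_mul_assoc, pow_succ', mul_assoc, smul_sub, sub_smul, smul_smul]
    rw [mul_comm (qintd d 2)]
    abel

lemma mul_pow_right (hd : 0 < d) (h : IsQSerre d e f) (p : ℕ) :
    f * e ^ (p + 1) =
      qintd d ((p : ℤ) + 1) • (e ^ p * f * e) - qintd d p • (e ^ (p + 1) * f) := by
  induction p with
  | zero => simp [qintd_one hd, qintd_zero]
  | succ p ih =>
    have h' : f * e * e = qintd d 2 • (e * f * e) - e * e * f := by
      rw [eq_sub_iff_add_eq, ← sub_eq_zero, ← h]
      abel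
    have h2 := qintd_add_two hd (p : ℤ)
    rw [pow_succ, ← mul_assoc, ih, sub_mul, smul_mul_assoc, smul_mul_assoc,
      mul_assoc (e ^ p), mul_assoc (e ^ p), h']
    push_cast
    rw [show (p : ℤ) + 1 + 1 = p + 2 by ring, h2]
    simp only [mul_sub, mul_smul_comm, pow_succ, mul_assoc, smul_sub, sub_smul, smul_smul]
    rw [mul_comm (qintd d 2)]
    abel

lemma exists_pow_mul_pow (hd : 0 < d) (h : IsQSerre d e f) (b c : ℕ) :
    ∃ y, e ^ (b + c) * f ^ c = y * e ^ b := by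
  induction c generalizing b with
  | zero => exact ⟨1, by simp⟩
  | succ c ih =>
    obtain ⟨y, hy⟩ := ih (b + 1)
    refine ⟨y * (qintd d ((b : ℤ) + 1) • (e * f) - qintd d b • (f * e)), ?_⟩
    rw [show b + (c + 1) = b + 1 + c by ring, pow_succ f, ← mul_assoc, hy, mul_assoc,
      h.pow_mul_right hd, mul_assoc y]
    simp only [sub_mul, smul_mul_assoc, pow_succ', mul_assoc]

/-- If `e`, `f` satisfy the quantum Serre relation and `e^{n+1}` kills `x`, then `e^b f^c` kills `x`
as soon as `b - c > n`. -/
lemma pow_mul_pow_apply_eq_zero {M : Type*} [AddCommGroup M] [Module F M]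
    {e f : Module.End F M} (hd : 0 < d) (h : IsQSerre d e f) {x : M} {n : ℕ}
    (hx : (e ^ (n + 1)) x = 0) {b c : ℕ} (hbc : n + c < b) : (e ^ b * f ^ c) x = 0 := by
  obtain ⟨k, rfl⟩ := Nat.exists_eq_add_of_lt hbc
  obtain ⟨y, hy⟩ := h.exists_pow_mul_pow hd (k + (n + 1)) c
  rw [show n + c + k + 1 = k + (n + 1) + c by ring, hy, pow_add, Module.End.mul_apply,
    Module.End.mul_apply, hx, map_zero, map_zero]

lemma mul_pow_mul_pow (hd : 0 < d) (hef : IsQSerre d e f) (hfe : IsQSerre d f e) (i p : ℕ) :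
    ∃ α β : F, e * f ^ (i + 1) * e ^ p =
      α • (f ^ i * e ^ (p + 1) * f) + β • (f ^ (i + 1) * e ^ (p + 1)) := by
  have h1 := hef.pow_mul_right hd p
  have hp : qintd d ((p : ℤ) + 1) ≠ 0 := qintd_ne_zero hd (by positivity)
  have h2 : e * f * e ^ p = (qintd d ((p : ℤ) + 1))⁻¹ •
      (e ^ (p + 1) * f + qintd d p • (f * e ^ (p + 1))) := by
    rw [h1, sub_add_cancel, smul_smul, inv_mul_cancel₀ hp, one_smul]
  refine ⟨qintd d ((i : ℤ) + 1) * (qintd d ((p : ℤ) + 1))⁻¹,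
    qintd d ((i : ℤ) + 1) * (qintd d ((p : ℤ) + 1))⁻¹ * qintd d p - qintd d i, ?_⟩
  rw [hfe.mul_pow_right hd i, sub_mul, smul_mul_assoc, smul_mul_assoc, mul_assoc (f ^ i),
    mul_assoc (f ^ i), h2]
  rw [show f ^ (i + 1) * e * e ^ p = f ^ (i + 1) * e ^ (p + 1) by rw [mul_assoc, ← pow_succ'],
    show f ^ i * ((qintd d ((p : ℤ) + 1))⁻¹ • (e ^ (p + 1) * f + qintd d p • (f * e ^ (p + 1)))) =
      (qintd d ((p : ℤ) + 1))⁻¹ • (f ^ i * e ^ (p + 1) * f + qintd d p • (f ^ (i + 1) * e ^ (p + 1)))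
      by simp only [mul_smul_comm, mul_add, pow_succ f, mul_assoc]]
  simp only [smul_add, smul_smul, sub_smul, mul_assoc]
  abel

/-- If `e`, `f` satisfy both quantum Serre relations and `e^{m+1}`, `f^{n+1}` kill `x`, then so does
every `e^a f^i e^p f^k` with `a + p > m + n`. -/
lemma pow_mul_pow_mul_pow_apply_eq_zero {M : Type*} [AddCommGroup M] [Module F M]
    {e f : Module.End F M} (hd : 0 < d) (hef : IsQSerre d e f) (hfe : IsQSerre d f e)
    {x : M} {m n : ℕ} (hm : (e ^ (m + 1)) x = 0) (hn : (f ^ (n + 1)) x = 0) (a : ℕ) :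
    ∀ i p k : ℕ, m + n < a + p → (e ^ a * f ^ i * e ^ p * f ^ k) x = 0 := by
  induction a with
  | zero =>
    intro i p k hp
    rw [pow_zero, one_mul, mul_assoc, Module.End.mul_apply]
    rcases le_or_gt k n with hk | hk
    · rw [hef.pow_mul_pow_apply_eq_zero hd hm (by omega), map_zero]
    · obtain ⟨j, rfl⟩ := Nat.exists_eq_add_of_lt hk
      rw [show n + j + 1 = j + (n + 1) by ring, pow_add f, Module.End.mul_apply,
        Module.End.mul_apply, hn, map_zero, map_zero, map_zero]
  | succ a ih =>
    intro i p k hp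
    cases i with
    | zero =>
      have h := ih 0 (p + 1) k (by omega)
      rwa [pow_zero, mul_one, pow_succ', ← mul_assoc, ← pow_succ, ← mul_one (e ^ (a + 1)),
        ← pow_zero f] at h
    | succ i =>
      obtain ⟨α, β, h⟩ := mul_pow_mul_pow hd hef hfe i p
      have key : e ^ (a + 1) * f ^ (i + 1) * e ^ p * f ^ k =
          α • (e ^ a * f ^ i * e ^ (p + 1) * f ^ (k + 1)) +
            β • (e ^ a * f ^ (i + 1) * e ^ (p + 1) * f ^ k) := by
        calc _ = e ^ a * (e * f ^ (i + 1) * e ^ p) * f ^ k := by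
              simp only [pow_succ e a, mul_assoc]
          _ = _ := by
              rw [h, pow_succ' f k]
              simp only [mul_add, add_mul, mul_smul_comm, smul_mul_assoc, mul_assoc]
      rw [key, LinearMap.add_apply, LinearMap.smul_apply, LinearMap.smul_apply,
        ih _ _ _ (by omega), ih _ _ _ (by omega), smul_zero, smul_zero, add_zero]

end IsQSerre

/-- If `a`, `b` and `u`, `v` satisfy the quantum Serre relation and `u`, `v` commute with `a`, `b` up
to the powers of `p` given by the Cartan matrix of type `A₂`, then the differences satisfy it. -/
lemma serre_sub {k S : Type*} [Field k] [Ring S] [Algebra k S] {p : k} (hp : p ≠ 0) {a b u v : S}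
    (hab : a * a * b - (p + p⁻¹) • (a * b * a) + b * a * a = 0)
    (huv : u * u * v - (p + p⁻¹) • (u * v * u) + v * u * u = 0)
    (hua : u * a = (p * p) • (a * u)) (hub : u * b = p⁻¹ • (b * u))
    (hva : v * a = p⁻¹ • (a * v)) :
    (a - u) * (a - u) * (b - v) - (p + p⁻¹) • ((a - u) * (b - v) * (a - u)) +
      (b - v) * (a - u) * (a - u) = 0 := by
  have hua' (z : S) : u * (a * z) = (p * p) • (a * (u * z)) := by
    rw [← mul_assoc, hua, smul_mul_assoc, mul_assoc]
  have hub' (z : S) : u * (b * z) = p⁻¹ • (b * (u * z)) := by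
    rw [← mul_assoc, hub, smul_mul_assoc, mul_assoc]
  have hva' (z : S) : v * (a * z) = p⁻¹ • (a * (v * z)) := by
    rw [← mul_assoc, hva, smul_mul_assoc, mul_assoc]
  have key : (a - u) * (a - u) * (b - v) - (p + p⁻¹) • ((a - u) * (b - v) * (a - u)) +
      (b - v) * (a - u) * (a - u) =
      (a * a * b - (p + p⁻¹) • (a * b * a) + b * a * a) -
      (u * u * v - (p + p⁻¹) • (u * v * u) + v * u * u) := by
    simp only [mul_sub, sub_mul, mul_assoc, hua, hub, hva, hua', hub', hva', mul_smul_comm,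
      smul_mul_assoc, smul_sub, smul_smul]
    match_scalars <;> field_simp <;> ring
  rw [key, hab, huv, sub_zero]

lemma IsQSerre.sub (hd : 0 < d) {a b u v : R} (hab : IsQSerre d a b) (huv : IsQSerre d u v)
    (hua : u * a = qz (2 * d) • (a * u)) (hub : u * b = qz (-d) • (b * u))
    (hva : v * a = qz (-d) • (a * v)) :
    IsQSerre d (a - u) (b - v) := by
  unfold IsQSerre at *
  rw [qintd_two hd] at *
  rw [two_mul, qz_add] at hua
  rw [qz_neg] at *
  exact serre_sub (qz_ne_zero d) hab huv hua hub hva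

end QuantumSerre

section Adjoint

variable {B : Type*} [Ring B] [Algebra F B]

lemma IsQSerre.map {R S : Type*} [Ring R] [Algebra F R] [Ring S] [Algebra F S] {d : ℕ} {e f : R}
    (h : IsQSerre d e f) (φ : R →ₐ[F] S) : IsQSerre d (φ e) (φ f) := by
  have h' := congrArg φ h
  simpa [IsQSerre, map_smul] using h'

/-- The `q`-commutation of `e` with `k` yields one with the inverse of `k`. -/
lemma mul_inv_eq_smul {e k k' : B} {s : F} (hk : k * k' = 1) (hk' : k' * k = 1)
    (h : k * e = s • (e * k)) : e * k' = s • (k' * e) := by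
  calc e * k' = k' * (k * e) * k' := by rw [← mul_assoc, hk', one_mul]
    _ = s • (k' * e * (k * k')) := by
      rw [h]
      simp only [mul_smul_comm, smul_mul_assoc, mul_assoc]
    _ = s • (k' * e) := by rw [hk, mul_one]

lemma inv_mul_inv_comm {B : Type*} [Ring B] {k k' l l' : B} (hk : k * k' = 1) (hk' : k' * k = 1)
    (hl : l * l' = 1) (hl' : l' * l = 1) (h : k * l = l * k) : l' * k' = k' * l' := by
  let u : Bˣ := ⟨k, k', hk, hk'⟩
  let v : Bˣ := ⟨l, l', hl, hl'⟩
  have huv : Commute u v := Units.ext h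
  exact congrArg Units.val huv.inv_inv.eq.symm

/-- The map `x ↦ k x g`. -/
def sandwich (k g : B) : Module.End F B := LinearMap.mulLeft F k * LinearMap.mulRight F g

lemma sandwich_apply (k g x : B) : sandwich k g x = k * (x * g) := rfl

/-- The linear operator underlying `adE`. -/
def adEnd (e k k' : B) : Module.End F B := Algebra.lmul F B e - sandwich k (k' * e)

lemma coe_adEnd (e k k' : B) : ⇑(adEnd e k k') = adE e k k' := by
  funext x
  simp [adEnd, sandwich_apply, adE, mul_assoc]

lemma adEdp_eq (d : ℕ) (e k k' : B) (a : ℕ) (x : B) :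
    adEdp d e k k' a x = (qfactd d a)⁻¹ • (adEnd e k k' ^ a) x := by
  rw [adEdp, Module.End.pow_apply, coe_adEnd]

lemma isQSerre_adEnd {d : ℕ} (hd : 0 < d) {e f k k' l l' : B}
    (hk : k * k' = 1) (hk' : k' * k = 1) (hl : l * l' = 1) (hl' : l' * l = 1)
    (hkl : k * l = l * k) (hke : k * e = qz (2 * d) • (e * k))
    (hkf : k * f = qz (-d) • (f * k)) (hle : l * e = qz (-d) • (e * l))
    (h : IsQSerre d e f) : IsQSerre d (adEnd e k k') (adEnd f l l') := by
  refine IsQSerre.sub hd (h.map _) ?_ ?_ ?_ ?_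
  · have hP := qz_ne_zero d
    have hek := mul_inv_eq_smul hk hk' hke
    have hfk := mul_inv_eq_smul hk hk' hkf
    have hel := mul_inv_eq_smul hl hl' hle
    have hlk := inv_mul_inv_comm hk hk' hl hl' hkl
    rw [two_mul, qz_add] at hek
    rw [qz_neg] at hfk hel
    have hek' (z : B) : e * (k' * z) = (qz d * qz d) • (k' * (e * z)) := by
      rw [← mul_assoc, hek, smul_mul_assoc, mul_assoc]
    have hfk' (z : B) : f * (k' * z) = (qz d)⁻¹ • (k' * (f * z)) := by
      rw [← mul_assoc, hfk, smul_mul_assoc, mul_assoc]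
    have hel' (z : B) : e * (l' * z) = (qz d)⁻¹ • (l' * (e * z)) := by
      rw [← mul_assoc, hel, smul_mul_assoc, mul_assoc]
    have hlk' (z : B) : l' * (k' * z) = k' * (l' * z) := by
      rw [← mul_assoc, hlk, mul_assoc]
    have hkl' (z : B) : l * (k * z) = k * (l * z) := by
      rw [← mul_assoc, ← hkl, mul_assoc]
    have c1 : k' * e * (k' * e) * (l' * f) = k' * k' * l' * (e * e * f) := by
      simp only [mul_assoc, hek', hel', mul_smul_comm, smul_mul_assoc, smul_smul]
      convert one_smul F _ using 2
      field_simp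
    have c2 : k' * e * (l' * f) * (k' * e) = k' * k' * l' * (e * f * e) := by
      simp only [mul_assoc, hek', hel', hfk', hlk', mul_smul_comm, smul_mul_assoc, smul_smul]
      convert one_smul F _ using 2
      field_simp
    have c3 : l' * f * (k' * e) * (k' * e) = k' * k' * l' * (f * e * e) := by
      simp only [mul_assoc, hek', hfk', hlk', mul_smul_comm, smul_mul_assoc, smul_smul]
      convert one_smul F _ using 2
      field_simp
    have h' : IsQSerre d (k' * e) (l' * f) := by
      rw [IsQSerre, c1, c2, c3, ← mul_smul_comm, ← mul_sub, ← mul_add, h, mul_zero]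
    generalize k' * e = e' at h'
    generalize l' * f = f' at h'
    refine LinearMap.ext fun x => ?_
    have key : k * k * l * x * (e' * e' * f' - qintd d 2 • (e' * f' * e') + f' * e' * e') = 0 := by
      rw [h', mul_zero]
    rw [LinearMap.zero_apply, ← key]
    simp only [LinearMap.add_apply, LinearMap.sub_apply, LinearMap.smul_apply,
      Module.End.mul_apply, sandwich_apply, mul_add, mul_sub, mul_smul_comm, mul_assoc, hkl']
    abel
  all_goals
    refine LinearMap.ext fun x => ?_
    simp only [Module.End.mul_apply, sandwich_apply, LinearMap.smul_apply, Algebra.coe_lmul_eq_mul,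
      LinearMap.mul_apply_apply]
  · rw [mul_assoc e, ← mul_assoc, hke, smul_mul_assoc, mul_assoc e k]
  · rw [mul_assoc f, ← mul_assoc, hkf, smul_mul_assoc, mul_assoc f k]
  · rw [mul_assoc e, ← mul_assoc, hle, smul_mul_assoc, mul_assoc e l]

lemma mul_dpd {d : ℕ} (hd : 0 < d) (e : B) (m : ℕ) :
    e * dpd d e m = qintd d ((m : ℤ) + 1) • dpd d e (m + 1) := by
  have h := qintd_ne_zero hd (m := (m : ℤ) + 1) (by positivity)
  rw [dpd, dpd, mul_smul_comm, pow_succ', smul_smul, qfactd_succ, mul_inv_rev, ← mul_assoc,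
    mul_inv_cancel₀ h, one_mul]

lemma dpd_mul {d : ℕ} (hd : 0 < d) (e : B) (m : ℕ) :
    dpd d e m * e = qintd d ((m : ℤ) + 1) • dpd d e (m + 1) := by
  rw [← mul_dpd hd, dpd, mul_smul_comm, smul_mul_assoc, pow_mul_comm']

lemma adE_eq_sub {e k k' x : B} {s : F} (hk : k * k' = 1) (hx : k * x = s • (x * k)) :
    adE e k k' x = e * x - s • (x * e) := by
  rw [adE, hx, smul_mul_assoc, mul_assoc x, hk, mul_one, smul_mul_assoc]

lemma mul_iterate_adE {d : ℕ} {c : ℤ} {e x k k' : B} (hk : k * k' = 1)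
    (hke : k * e = qz (2 * d) • (e * k)) (hkx : k * x = qz (d * c) • (x * k)) (n : ℕ) :
    k * (adE e k k')^[n] x = qz (d * (2 * n + c)) • ((adE e k k')^[n] x * k) := by
  induction n with
  | zero => simpa using hkx
  | succ n ih =>
    rw [Function.iterate_succ_apply', adE_eq_sub hk ih]
    generalize (adE e k k')^[n] x = y at ih
    have h1 : k * (e * y) = qz (d * (2 * (n + 1 : ℕ) + c)) • (e * y * k) := by
      rw [← mul_assoc, hke, smul_mul_assoc, mul_assoc, ih, mul_smul_comm, smul_smul, ← qz_add,
        mul_assoc]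
      congr 2
      push_cast
      ring
    have h2 : k * (y * e) = qz (d * (2 * (n + 1 : ℕ) + c)) • (y * e * k) := by
      rw [← mul_assoc, ih, smul_mul_assoc, mul_assoc, hke, mul_smul_comm, smul_smul, ← qz_add,
        mul_assoc]
      congr 2
      push_cast
      ring
    rw [mul_sub, mul_smul_comm, h1, h2, sub_mul, smul_mul_assoc, smul_sub,
      smul_comm (qz (d * (2 * n + c)))]

/-- Expansion of `ad(e)ⁿ(x)` for a weight vector `x`. -/
lemma iterate_adE_eq_sum {d : ℕ} (hd : 0 < d) {c : ℤ} {e x k k' : B} (hk : k * k' = 1)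
    (hke : k * e = qz (2 * d) • (e * k)) (hkx : k * x = qz (d * c) • (x * k)) (n : ℕ) :
    (adE e k k')^[n] x = ∑ r ∈ Finset.range (n + 1),
      ((-1) ^ r * qz (d * (r * (n - 1 + c))) * qfactd d n) •
        (dpd d e (n - r) * x * dpd d e r) := by
  induction n with
  | zero => simp [dpd, qfactd, qz_zero]
  | succ n ih =>
    rw [Function.iterate_succ_apply', adE_eq_sub hk (mul_iterate_adE hk hke hkx n), ih]
    have split (r : ℕ) : (-1) ^ r * qz (d * (r * ((n + 1 : ℕ) - 1 + c))) * qfactd d (n + 1) =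
        (-1) ^ r * qz (d * (r * (n - 1 + c))) * qfactd d n * qintd d (((n : ℤ) + 1) - r) +
        (-1) ^ r * qz (d * ((r - 1) * (n - 1 + c))) * qz (d * (2 * n + c)) * qfactd d n *
          qintd d r := by
      have h1 : qz (d * ((r - 1) * (n - 1 + c))) * qz (d * (2 * n + c)) =
          qz (d * (r * (n - 1 + c))) * qz (d * (n + 1)) := by
        rw [← qz_add, ← qz_add]
        congr 1
        ring
      have h2 : qz (d * (r * ((n + 1 : ℕ) - 1 + c))) = qz (d * (r * (n - 1 + c))) * qz (d * r) := by
        rw [← qz_add]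
        congr 1
        push_cast
        ring
      rw [h2, qfactd_succ]
      linear_combination (-(-1) ^ r * qz (d * (r * (n - 1 + c))) * qfactd d n) *
        qintd_pascal d (n + 1) r - (-1) ^ r * qfactd d n * qintd d r * h1
    simp only [split, add_smul, Finset.sum_add_distrib]
    rw [Finset.sum_range_succ _ (n + 1), Finset.sum_range_succ' _ (n + 1), sub_eq_add_neg]
    simp only [Nat.cast_add, Nat.cast_one, sub_self, qintd_zero, mul_zero, zero_smul, add_zero,
      Nat.cast_zero]
    rw [Finset.mul_sum, Finset.sum_mul, Finset.smul_sum, ← Finset.sum_neg_distrib]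
    congr 1
    · refine Finset.sum_congr rfl fun r hr => ?_
      have hr' : r ≤ n := by simpa [Nat.lt_succ_iff] using hr
      rw [mul_smul_comm, ← mul_assoc e, ← mul_assoc e, mul_dpd hd, smul_mul_assoc, smul_mul_assoc,
        smul_smul, Nat.sub_add_comm hr', Nat.cast_sub hr']
      congr 3
      ring
    · refine Finset.sum_congr rfl fun r hr => ?_
      rw [smul_mul_assoc, mul_assoc _ (dpd d e r), dpd_mul hd, mul_smul_comm, smul_smul, smul_smul, ← neg_smul,
        Nat.add_sub_add_right]
      congr 1
      rw [add_sub_cancel_right, pow_succ]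
      ring

/-- The quantum Serre relation in adjoint form. -/
lemma adEnd_pow_apply_eq_zero {d : ℕ} (hd : 0 < d) {m : ℕ} {e x k k' : B} (hk : k * k' = 1)
    (hke : k * e = qz (2 * d) • (e * k)) (hkx : k * x = qz (d * (-m : ℤ)) • (x * k))
    (h : ∑ r ∈ Finset.range (m + 1 + 1),
      ((-1 : F) ^ r) • (dpd d e r * x * dpd d e (m + 1 - r)) = 0) :
    (adEnd e k k' ^ (m + 1)) x = 0 := by
  rw [Module.End.pow_apply, coe_adEnd, iterate_adE_eq_sum hd hk hke hkx,
    ← Finset.sum_range_reflect]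
  rw [← smul_zero ((-1) ^ (m + 1) * qfactd d (m + 1)), ← h, Finset.smul_sum]
  refine Finset.sum_congr rfl fun r hr => ?_
  have hr' : r ≤ m + 1 := by simpa [Nat.lt_succ_iff] using hr
  obtain ⟨j, hj⟩ := Nat.exists_eq_add_of_le hr'
  rw [show m + 1 + 1 - 1 - r = j by omega, show m + 1 - j = r by omega,
    show m + 1 - r = j by omega, smul_smul]
  congr 1
  rw [hj, pow_add, show ((r + j : ℕ) : ℤ) - 1 + -(m : ℤ) = 0 by omega, mul_zero, mul_zero, qz_zero]
  have h1 : ((-1 : F) ^ r) * (-1) ^ r = 1 := by rw [← mul_pow]; simp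
  linear_combination (-(-1) ^ j * qfactd d (r + j)) * h1

lemma isQSerre_of_sum {d : ℕ} (hd : 0 < d) {e f : B}
    (h : ∑ r ∈ Finset.range (2 + 1), ((-1 : F) ^ r) • (dpd d e r * f * dpd d e (2 - r)) = 0) :
    IsQSerre d e f := by
  have h2 : qintd d 2 ≠ 0 := qintd_ne_zero hd (by norm_num)
  have f2 : qfactd d 2 = qintd d 2 := by
    simp [qfactd, Finset.prod_range_succ, qintd_one hd, one_add_one_eq_two]
  have f1 : qfactd d 1 = 1 := by simp [qfactd, qintd_one hd]
  have f0 : qfactd d 0 = 1 := by simp [qfactd]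
  have h' := congrArg (qintd d 2 • ·) h
  simp only [Finset.sum_range_succ, Finset.sum_range_zero, dpd, f0, f1, f2, smul_add, smul_zero,
    smul_mul_assoc, mul_smul_comm, smul_smul, Nat.sub_self, Nat.sub_zero, pow_zero, pow_one,
    inv_one, one_smul, mul_one, one_mul, zero_add, mul_inv_cancel₀ h2, Nat.reduceSub,
    neg_smul, neg_one_sq, pow_two e, mul_assoc, smul_neg] at h'
  rw [IsQSerre, ← h']
  simp only [mul_assoc]
  abel

end Adjoint

end Serre3

/-- Lemma 2.11 (`lem:qsvanish`, reformulated via the adjoint action as in its proof):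
let `U` be the quantum group attached to a rank-3 symmetrizable GCM `c` with
`c₁₂ = c₂₁ = −1`. If `c > −c₁₃`, or `b − c > −c₂₃`, or `a + c > −c₁₃ − c₂₃`, then
`ad(E₁)^{(a)}(ad(E₂)^{(b)}(ad(E₁)^{(c)}(E₃))) = 0`. Here the presented quantum group is
formalized by quantifying over all algebras with generators satisfying its relations. -/
theorem statement16 (A : Type*) [Ring A] [Algebra F A]
    (c : Fin 3 → Fin 3 → ℤ) (d : Fin 3 → ℕ)
    (hdiag : ∀ k, c k k = 2)
    (hoff : ∀ k l, k ≠ l → c k l ≤ 0)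
    (hdpos : ∀ k, 0 < d k)
    (hsym : ∀ k l, (d k : ℤ) * c k l = (d l : ℤ) * c l k)
    (hc01 : c 0 1 = -1) (hc10 : c 1 0 = -1)
    (E Fg Kk Kk' : Fin 3 → A)
    (hKu : ∀ k, Kk k * Kk' k = 1) (hKu' : ∀ k, Kk' k * Kk k = 1)
    (hKcomm : ∀ k l, Kk k * Kk l = Kk l * Kk k)
    (hKE : ∀ k l, Kk k * E l = qz ((d k : ℤ) * c k l) • (E l * Kk k))
    (hKF : ∀ k l, Kk k * Fg l = qz (-((d k : ℤ) * c k l)) • (Fg l * Kk k))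
    (hEF : ∀ k l, E k * Fg l - Fg l * E k =
      if k = l then (qz (d k : ℤ) - qz (-(d k : ℤ)))⁻¹ • (Kk k - Kk' k) else 0)
    (hSerreE : ∀ k l, k ≠ l →
      ∑ r ∈ Finset.range ((1 - c k l).toNat + 1),
        ((-1 : F) ^ r) •
          (dpd (d k) (E k) r * E l * dpd (d k) (E k) ((1 - c k l).toNat - r)) = 0)
    (hSerreF : ∀ k l, k ≠ l →
      ∑ r ∈ Finset.range ((1 - c k l).toNat + 1),
        ((-1 : F) ^ r) •
          (dpd (d k) (Fg k) r * Fg l * dpd (d k) (Fg k) ((1 - c k l).toNat - r)) = 0)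
    (a b cc : ℕ)
    (h : -(c 0 2) < (cc : ℤ) ∨ -(c 1 2) < (b : ℤ) - (cc : ℤ)
        ∨ -(c 0 2) - c 1 2 < (a : ℤ) + (cc : ℤ)) :
    adEdp (d 0) (E 0) (Kk 0) (Kk' 0) a
      (adEdp (d 1) (E 1) (Kk 1) (Kk' 1) b
        (adEdp (d 0) (E 0) (Kk 0) (Kk' 0) cc (E 2))) = 0 := by
  have hd01 : d 0 = d 1 := by
    have := hsym 0 1
    rw [hc01, hc10] at this
    omega
  have h01 : IsQSerre (d 0) (E 0) (E 1) := by
    refine isQSerre_of_sum (hdpos 0) ?_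
    simpa [hc01] using hSerreE 0 1 (by decide)
  have h10 : IsQSerre (d 0) (E 1) (E 0) := by
    rw [hd01]
    refine isQSerre_of_sum (hdpos 1) ?_
    simpa [hc10] using hSerreE 1 0 (by decide)
  have hself (k : Fin 3) : Kk k * E k = qz (2 * d k) • (E k * Kk k) := by
    rw [hKE, hdiag, mul_comm]
  have hK01 : Kk 0 * E 1 = qz (-d 0) • (E 1 * Kk 0) := by
    rw [hKE, hc01, mul_neg_one]
  have hK10 : Kk 1 * E 0 = qz (-d 0) • (E 0 * Kk 1) := by
    rw [hKE, hc10, mul_neg_one, hd01]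
  have hself1 : Kk 1 * E 1 = qz (2 * d 0) • (E 1 * Kk 1) := by rw [hself, hd01]
  have hef := isQSerre_adEnd (hdpos 0) (hKu 0) (hKu' 0) (hKu 1) (hKu' 1) (hKcomm 0 1)
    (hself 0) hK01 hK10 h01
  have hfe := isQSerre_adEnd (hdpos 0) (hKu 1) (hKu' 1) (hKu 0) (hKu' 0) (hKcomm 1 0)
    hself1 hK10 hK01 h10
  obtain ⟨m, hm⟩ := Int.eq_ofNat_of_zero_le (neg_nonneg.mpr (hoff 0 2 (by decide)))
  obtain ⟨n, hn⟩ := Int.eq_ofNat_of_zero_le (neg_nonneg.mpr (hoff 1 2 (by decide)))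
  have hem := adEnd_pow_apply_eq_zero (m := m) (x := E 2) (hdpos 0) (hKu 0) (hself 0)
    (by rw [hKE, show c 0 2 = -(m : ℤ) by omega]) (by
      have h := hSerreE 0 2 (by decide)
      rwa [show (1 - c 0 2).toNat = m + 1 by omega] at h)
  have hfn := adEnd_pow_apply_eq_zero (m := n) (x := E 2) (hdpos 1) (hKu 1) (hself 1)
    (by rw [hKE, show c 1 2 = -(n : ℤ) by omega]) (by
      have h := hSerreE 1 2 (by decide)
      rwa [show (1 - c 1 2).toNat = n + 1 by omega] at h)
  simp only [adEdp_eq, map_smul]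
  generalize adEnd (E 0) (Kk 0) (Kk' 0) = e at *
  generalize adEnd (E 1) (Kk 1) (Kk' 1) = f at *
  suffices hmain : (e ^ a) ((f ^ b) ((e ^ cc) (E 2))) = 0 by simp only [hmain, smul_zero]
  rcases h with h | h | h
  · obtain ⟨j, rfl⟩ := Nat.exists_eq_add_of_lt (show m < cc by omega)
    rw [show m + j + 1 = j + (m + 1) by ring, pow_add e, Module.End.mul_apply, hem, map_zero,
      map_zero, map_zero]
  · have h0 := hfe.pow_mul_pow_apply_eq_zero (hdpos 0) hfn (show n + cc < b by omega)
    rw [Module.End.mul_apply] at h0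
    rw [h0, map_zero]
  · have h0 := IsQSerre.pow_mul_pow_mul_pow_apply_eq_zero (hdpos 0) hef hfe hem hfn a b cc 0
      (by omega)
    simpa only [pow_zero, mul_one, Module.End.mul_apply] using h0
end
end

section
/- In the algebra U_q(sl₃) of the context, for all integers b, c ≥ 0 the following identity holds: B₂^{(b)} B₁^{(c)} = Σ_{l=0}^{b} Σ_{t=0}^{c} Σ_{s=0}^{min(b−l, t)} ς₂^{b−l} q^{−(b−l)(b−3l+1+2t−2s)/2} q^{t(c−t)} (1/[s]!) · F₂^{(l)} F₁^{(t−s)} K₂^{l−b} ( ∏_{j=1}^{s} [K₁; s+l−b−t+j] ) E₁^{(b−l−s)} (ς₁ E₂ K₁^{−1})^{(c−t)}, where [K₁; a] := (K₁ q^{a} − K₁^{−1} q^{−a})/(q − q^{−1}) for a ∈ ℤ, and (ς₁E₂K₁^{−1})^{(j)} := (ς₁E₂K₁^{−1})^j/[j]!. -/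
noncomputable section

namespace Uqsl3

/-- The base field `F = ℚ(q)`. -/
abbrev F : Type := RatFunc ℚ

/-- `q^e` for `e : ℤ`. -/
def qz (e : ℤ) : F := (RatFunc.X : F) ^ e

/-- The quantum integer `[n]`. -/
def qint (n : ℤ) : F := (qz n - qz (-n)) / (qz 1 - qz (-1))

/-- The quantum factorial `[n]!`. -/
def qfact (n : ℕ) : F := ∏ i ∈ Finset.range n, qint ((i : ℤ) + 1)

/-- The balanced Gaussian binomial `⌊a ¦ k⌋ = ∏_{s=1}^{k}(q^{a−s+1}−q^{−a+s−1})/(q^s−q^{−s})`. -/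
def qbinom (a : ℤ) (k : ℕ) : F :=
  ∏ s ∈ Finset.range k,
    (qz (a - s) - qz (-(a - s))) / (qz ((s : ℤ) + 1) - qz (-((s : ℤ) + 1)))

variable {A : Type*} [Ring A] [Algebra F A]

/-- Divided power `x^{(m)} = x^m/[m]!` for `m : ℕ`. -/
def dpn (x : A) (m : ℕ) : A := (qfact m)⁻¹ • x ^ m

/-- `[K₁; a] = (K₁q^a − K₁⁻¹q^{−a})/(q − q^{−1})`. -/
def Kbr (k kinv : A) (a : ℤ) : A := (qz 1 - qz (-1))⁻¹ • (qz a • k - qz (-a) • kinv)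

end Uqsl3

open Uqsl3

namespace Uqsl3

lemma qz_zero : qz 0 = 1 := by simp [qz]

lemma qz_ne_zero (a : ℤ) : qz a ≠ 0 := zpow_ne_zero _ RatFunc.X_ne_zero

lemma qz_add (a b : ℤ) : qz (a + b) = qz a * qz b := zpow_add₀ RatFunc.X_ne_zero _ _

lemma qz_neg (a : ℤ) : qz (-a) = (qz a)⁻¹ := zpow_neg _ _

lemma qz_sub (a b : ℤ) : qz (a - b) = qz a * (qz b)⁻¹ := by
  rw [sub_eq_add_neg, qz_add, qz_neg]

lemma qz_natCast_mul (a : ℤ) (n : ℕ) : qz (n * a) = qz a ^ n := by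
  rw [qz, mul_comm, zpow_mul, zpow_natCast, qz]

lemma qz_sub_qz_neg_ne_zero {n : ℕ} (hn : n ≠ 0) : qz n - qz (-(n : ℤ)) ≠ 0 := by
  intro h
  have h1 : (RatFunc.X : F) ^ (n + n) = 1 := by
    have h2 : qz n * qz n = qz n * qz (-(n : ℤ)) := by rw [sub_eq_zero.mp h]
    rw [← qz_add, ← qz_add, add_neg_cancel, qz_zero] at h2
    rw [← h2, qz]
    exact_mod_cast rfl
  rw [← RatFunc.algebraMap_X, ← map_pow, ← map_one (algebraMap (Polynomial ℚ) F)] at h1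
  have h3 := congrArg Polynomial.natDegree (RatFunc.algebraMap_injective ℚ h1)
  simp at h3
  exact hn h3

lemma qz_one_sub_ne_zero : qz 1 - qz (-1) ≠ 0 := by
  exact_mod_cast qz_sub_qz_neg_ne_zero one_ne_zero

lemma qint_natCast_ne_zero {n : ℕ} (hn : n ≠ 0) : qint n ≠ 0 :=
  div_ne_zero (qz_sub_qz_neg_ne_zero hn) qz_one_sub_ne_zero

lemma qint_zero : qint 0 = 0 := by simp [qint]

lemma qint_one : qint 1 = 1 := div_self qz_one_sub_ne_zero

lemma qint_add (a b : ℤ) : qint (a + b) = qz (-b) * qint a + qz a * qint b := by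
  simp only [qint, neg_add, qz_add]
  ring

lemma qfact_succ (n : ℕ) : qfact (n + 1) = qfact n * qint ((n + 1 : ℕ) : ℤ) := by
  rw [qfact, Finset.prod_range_succ, qfact]
  push_cast
  rfl

variable {A : Type*} [Ring A] [Algebra F A]

lemma dpn_zero (x : A) : dpn x 0 = 1 := by simp [dpn, qfact]

lemma qint_smul_dpn_succ (x : A) (n : ℕ) :
    qint ((n + 1 : ℕ) : ℤ) • dpn x (n + 1) = x * dpn x n := by
  rw [dpn, qfact_succ, smul_smul, mul_inv, mul_left_comm,
    mul_inv_cancel₀ (qint_natCast_ne_zero n.succ_ne_zero), mul_one, pow_succ', dpn, mul_smul_comm]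

lemma mul_pow_of_skew {x y : A} {r : F} (h : y * x = r • (x * y)) (n : ℕ) :
    y * x ^ n = r ^ n • (x ^ n * y) := by
  induction n with
  | zero => simp
  | succ n ih =>
    rw [pow_succ, ← mul_assoc, ih, smul_mul_assoc, mul_assoc, h, mul_smul_comm, smul_smul,
      mul_assoc, pow_succ]

lemma pow_mul_pow_of_skew {x y : A} {r : F} (h : y * x = r • (x * y)) (m n : ℕ) :
    y ^ m * x ^ n = r ^ (m * n) • (x ^ n * y ^ m) := by
  induction m with
  | zero => simp
  | succ m ih =>
    rw [pow_succ', mul_assoc, ih, mul_smul_comm, ← mul_assoc, mul_pow_of_skew h, smul_mul_assoc,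
      smul_smul, mul_assoc, add_mul, one_mul, pow_add]

lemma mul_dpn_of_skew {x y : A} {a : ℤ} (h : y * x = qz a • (x * y)) (n : ℕ) :
    y * dpn x n = qz (n * a) • (dpn x n * y) := by
  rw [dpn, mul_smul_comm, mul_pow_of_skew h, smul_mul_assoc, smul_comm, qz_natCast_mul]

/-- The quantum binomial theorem for divided powers of skew-commuting elements. -/
lemma dpn_add_of_skew {x y : A} (h : y * x = qz 2 • (x * y)) (n : ℕ) :
    dpn (x + y) n = ∑ p ∈ Finset.HasAntidiagonal.antidiagonal n,
      qz ((p.1 : ℤ) * p.2) • (dpn x p.1 * dpn y p.2) := by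
  induction n with
  | zero => simp [dpn_zero, qz_zero]
  | succ n ih =>
    have hn := qint_natCast_ne_zero n.succ_ne_zero
    apply smul_right_injective A hn
    simp only
    rw [qint_smul_dpn_succ, ih, add_mul, Finset.mul_sum, Finset.mul_sum, Finset.smul_sum]
    have hsplit : ∀ p ∈ Finset.HasAntidiagonal.antidiagonal (n + 1),
        qint ((n + 1 : ℕ) : ℤ) • qz ((p.1 : ℤ) * p.2) • (dpn x p.1 * dpn y p.2)
          = (qz ((p.1 : ℤ) * p.2 - p.2) * qint p.1) • (dpn x p.1 * dpn y p.2)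
            + (qz ((p.1 : ℤ) * p.2 + p.1) * qint p.2) • (dpn x p.1 * dpn y p.2) := by
      intro p hp
      rw [← Finset.HasAntidiagonal.mem_antidiagonal.mp hp, ← add_smul, smul_smul]
      congr 1
      push_cast
      rw [qint_add, sub_eq_add_neg, qz_add, qz_add]
      ring
    rw [Finset.sum_congr rfl hsplit, Finset.sum_add_distrib,
      Finset.Nat.sum_antidiagonal_succ, Finset.Nat.sum_antidiagonal_succ']
    simp only [Nat.cast_zero, qint_zero, mul_zero, zero_smul, zero_add]
    congr 1
    · refine Finset.sum_congr rfl fun p _ => ?_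
      rw [mul_smul_comm, ← mul_assoc, ← qint_smul_dpn_succ, smul_mul_assoc, smul_smul]
      congr 3
      push_cast
      ring
    · refine Finset.sum_congr rfl fun p _ => ?_
      rw [mul_smul_comm, ← mul_assoc, mul_dpn_of_skew h, smul_mul_assoc, mul_assoc,
        ← qint_smul_dpn_succ, mul_smul_comm, smul_smul, smul_smul, ← qz_add]
      congr 3
      push_cast
      ring

lemma dpn_mul_of_skew {x y : A} (h : x * y = qz (-1) • (y * x)) (r : F) (n : ℕ) :
    dpn (r • (x * y)) n = (r ^ n * qz (-((n : ℤ) * (n + 1)) / 2)) • (y ^ n * dpn x n) := by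
  have key : (x * y) ^ n = qz (-((n : ℤ) * (n + 1)) / 2) • (y ^ n * x ^ n) := by
    induction n with
    | zero => simp [qz_zero]
    | succ n ih =>
      have hx : x * y ^ n = qz (n * (-1)) • (y ^ n * x) := by
        rw [mul_pow_of_skew h, qz_natCast_mul]
      have hexp : -(((n + 1 : ℕ) : ℤ) * ((n + 1 : ℕ) + 1)) / 2
          = -((n : ℤ) * (n + 1)) / 2 + (-1) + n * (-1) := by
        have : -(((n + 1 : ℕ) : ℤ) * ((n + 1 : ℕ) + 1))
            = -((n : ℤ) * (n + 1)) + (-(n : ℤ) - 1) * 2 := by push_cast; ring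
        rw [this, Int.add_mul_ediv_right _ _ two_ne_zero]
        ring
      rw [pow_succ', ih, h, smul_mul_assoc, mul_smul_comm, mul_assoc, ← mul_assoc x, hx,
        smul_mul_assoc, mul_smul_comm, mul_assoc (y ^ n), ← pow_succ' x, ← mul_assoc y,
        ← pow_succ' y, smul_smul, smul_smul, hexp, qz_add, qz_add]
      congr 1
      ring
  rw [dpn, smul_pow, key, dpn, mul_smul_comm, smul_smul, smul_smul, smul_smul]
  congr 1
  ring

lemma Kbr_add (k k' : A) (m n x : ℤ) :
    qint m • Kbr k k' (x - (m + n)) + qint n • Kbr k k' x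
      = qint (m + n) • Kbr k k' (x - m) := by
  have hq := qz_one_sub_ne_zero
  have hm := qz_ne_zero m
  have hn := qz_ne_zero n
  have hx := qz_ne_zero x
  simp only [Kbr, smul_sub, smul_smul]
  have e1 : qint m * ((qz 1 - qz (-1))⁻¹ * qz (x - (m + n)))
      + qint n * ((qz 1 - qz (-1))⁻¹ * qz x)
      = qint (m + n) * ((qz 1 - qz (-1))⁻¹ * qz (x - m)) := by
    simp only [qint, qz_sub, qz_add, qz_neg m, qz_neg n, qz_neg (m + n)]
    field_simp
    ring
  have e2 : qint m * ((qz 1 - qz (-1))⁻¹ * qz (-(x - (m + n))))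
      + qint n * ((qz 1 - qz (-1))⁻¹ * qz (-x))
      = qint (m + n) * ((qz 1 - qz (-1))⁻¹ * qz (-(x - m))) := by
    simp only [qint, qz_sub, qz_add, qz_neg m, qz_neg n, qz_neg x, qz_neg (m + n), neg_sub]
    field_simp
    ring
  rw [← e1, ← e2, add_smul, add_smul]
  abel

lemma Kbr_mul_of_skew {k k' x : A} {d : ℤ} (h : k * x = qz d • (x * k))
    (h' : k' * x = qz (-d) • (x * k')) (a : ℤ) : Kbr k k' a * x = x * Kbr k k' (a + d) := by
  rw [Kbr, Kbr, smul_mul_assoc, mul_smul_comm, sub_mul, mul_sub, smul_mul_assoc, smul_mul_assoc,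
    h, h', mul_smul_comm, mul_smul_comm, smul_smul, smul_smul, ← qz_add, ← qz_add, neg_add]

lemma inv_mul_of_skew {k k' x : A} {d : ℤ} (h1 : k * k' = 1) (h2 : k' * k = 1)
    (h : k * x = qz d • (x * k)) : k' * x = qz (-d) • (x * k') := by
  have h3 : x * k' = qz d • (k' * x) := by
    calc x * k' = k' * (k * x) * k' := by rw [← mul_assoc, h2, one_mul]
      _ = qz d • (k' * x) := by
        rw [h, mul_smul_comm, smul_mul_assoc, mul_assoc, mul_assoc, h1, mul_one]
  rw [h3, smul_smul, ← qz_add, neg_add_cancel, qz_zero, one_smul]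

lemma mul_inv_of_skew {k k' x : A} {d : ℤ} (h1 : k * k' = 1) (h2 : k' * k = 1)
    (h : k * x = qz d • (x * k)) : x * k' = qz d • (k' * x) := by
  rw [inv_mul_of_skew h1 h2 h, smul_smul, ← qz_add, add_neg_cancel, qz_zero, one_smul]

/-- The product `∏_{j=1}^{s} [K; a + j]`. -/
def KbrProd (k k' : A) (s : ℕ) (a : ℤ) : A :=
  ((List.range s).map fun j : ℕ => Kbr k k' (a + ((j : ℤ) + 1))).prod

lemma KbrProd_succ (k k' : A) (s : ℕ) (a : ℤ) :
    KbrProd k k' (s + 1) a = KbrProd k k' s a * Kbr k k' (a + (s + 1)) := by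
  simp [KbrProd, List.range_succ]

lemma KbrProd_succ' (k k' : A) (s : ℕ) (a : ℤ) :
    KbrProd k k' (s + 1) a = Kbr k k' (a + 1) * KbrProd k k' s (a + 1) := by
  simp only [KbrProd, List.range_succ_eq_map, List.map_cons, List.prod_cons, List.map_map]
  refine congrArg₂ _ ?_ ?_
  · simp
  · refine congrArg (fun f => (List.map f (List.range s)).prod) (funext fun j => ?_)
    simp only [Function.comp]
    congr 1
    push_cast
    ring

lemma Kbr_commute {k k' : A} (h : Commute k k') (a b : ℤ) :
    Commute (Kbr k k' a) (Kbr k k' b) := by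
  unfold Kbr
  refine Commute.smul_left (Commute.smul_right (.sub_left (.sub_right ?_ ?_) (.sub_right ?_ ?_)) _) _
  · exact ((Commute.refl k).smul_left _).smul_right _
  · exact (h.smul_left _).smul_right _
  · exact (h.symm.smul_left _).smul_right _
  · exact ((Commute.refl k').smul_left _).smul_right _

lemma Kbr_commute_KbrProd {k k' : A} (h : Commute k k') (a b : ℤ) (s : ℕ) :
    Commute (Kbr k k' a) (KbrProd k k' s b) := by
  induction s with
  | zero => exact Commute.one_right _
  | succ s ih =>
    rw [KbrProd_succ]
    exact ih.mul_right (Kbr_commute h _ _)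

lemma mul_KbrProd_of_skew {k k' x : A} {d : ℤ} (h : k * x = qz d • (x * k))
    (h' : k' * x = qz (-d) • (x * k')) (s : ℕ) (a : ℤ) :
    x * KbrProd k k' s a = KbrProd k k' s (a - d) * x := by
  induction s with
  | zero => simp [KbrProd]
  | succ s ih =>
    have hx : x * Kbr k k' (a + (s + 1)) = Kbr k k' (a - d + (s + 1)) * x := by
      rw [Kbr_mul_of_skew h h']
      congr 2
      ring
    rw [KbrProd_succ, KbrProd_succ, ← mul_assoc, ih, mul_assoc, hx, mul_assoc]

section Sl2

variable {E G k k' : A}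

lemma mul_pow_succ_of_sl2 (hG : k * G = qz (-2) • (G * k)) (hG' : k' * G = qz (- -2) • (G * k'))
    (hEG : E * G - G * E = (qz 1 - qz (-1))⁻¹ • (k - k')) (t : ℕ) :
    E * G ^ (t + 1)
      = G ^ (t + 1) * E + qint ((t + 1 : ℕ) : ℤ) • (G ^ t * Kbr k k' (-t)) := by
  have h0 : E * G = G * E + Kbr k k' 0 := by
    rw [Kbr, neg_zero, qz_zero, one_smul, one_smul, ← hEG]
    abel
  induction t with
  | zero => simp [h0, qint_one]
  | succ t ih =>
    have hK := Kbr_add k k' ((t + 1 : ℕ) : ℤ) 1 0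
    rw [qint_one, one_smul, ← Nat.cast_succ, zero_sub, zero_sub] at hK
    rw [pow_succ, ← mul_assoc, ih, add_mul, mul_assoc, h0, smul_mul_assoc, mul_assoc,
      Kbr_mul_of_skew hG hG', ← mul_assoc (G ^ t), ← pow_succ,
      ← mul_smul_comm (qint ((t + 1 + 1 : ℕ) : ℤ)), ← hK, mul_add, mul_add,
      mul_assoc (G ^ (t + 1)) G E, mul_smul_comm]
    have : -(t : ℤ) + -2 = -((t + 1).succ : ℕ) := by push_cast; ring
    rw [this]
    abel

lemma mul_dpn_succ_of_sl2 (hG : k * G = qz (-2) • (G * k))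
    (hG' : k' * G = qz (- -2) • (G * k'))
    (hEG : E * G - G * E = (qz 1 - qz (-1))⁻¹ • (k - k')) (t : ℕ) :
    E * dpn G (t + 1) = dpn G (t + 1) * E + dpn G t * Kbr k k' (-t) := by
  rw [dpn, mul_smul_comm, mul_pow_succ_of_sl2 hG hG' hEG, smul_add, smul_mul_assoc, smul_smul,
    dpn, smul_mul_assoc, qfact_succ, mul_inv, mul_assoc,
    inv_mul_cancel₀ (qint_natCast_ne_zero t.succ_ne_zero), mul_one]

/-- `x^{(t-s)}`, which vanishes for `s > t`. -/
def dpnSub (x : A) (t s : ℕ) : A := if s ≤ t then dpn x (t - s) else 0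

lemma mul_dpnSub_of_sl2 (hG : k * G = qz (-2) • (G * k))
    (hG' : k' * G = qz (- -2) • (G * k'))
    (hEG : E * G - G * E = (qz 1 - qz (-1))⁻¹ • (k - k')) (t s : ℕ) :
    E * dpnSub G t s
      = dpnSub G t s * E + dpnSub G t (s + 1) * Kbr k k' ((s : ℤ) + 1 - t) := by
  rcases lt_trichotomy s t with h | rfl | h
  · obtain ⟨u, rfl⟩ := Nat.exists_eq_add_of_lt h
    rw [dpnSub, if_pos h.le, dpnSub, if_pos (Nat.succ_le_of_lt h), show s + u + 1 - s = u + 1 by omega,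
      show s + u + 1 - (s + 1) = u by omega, mul_dpn_succ_of_sl2 hG hG' hEG]
    congr 3
    push_cast
    ring
  · simp [dpnSub, dpn_zero]
  · simp [dpnSub, h.not_ge, (h.trans s.lt_succ_self).not_ge]

/-- The commutation formula for divided powers in `U_q(sl₂)`. -/
lemma dpn_mul_dpn_of_sl2 (h1 : k * k' = 1) (h2 : k' * k = 1)
    (hE : k * E = qz 2 • (E * k)) (hG : k * G = qz (-2) • (G * k))
    (hEG : E * G - G * E = (qz 1 - qz (-1))⁻¹ • (k - k')) (n t : ℕ) :
    dpn E n * dpn G t = ∑ s ∈ Finset.range (n + 1),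
      (qfact s)⁻¹ • (dpnSub G t s * KbrProd k k' s ((s : ℤ) - n - t) * dpn E (n - s)) := by
  have hE' := inv_mul_of_skew h1 h2 hE
  have hG' := inv_mul_of_skew h1 h2 hG
  have hc : Commute k k' := h1.trans h2.symm
  induction n with
  | zero => simp [dpn_zero, dpnSub, KbrProd, qfact]
  | succ n ih =>
    have hn := qint_natCast_ne_zero n.succ_ne_zero
    apply smul_right_injective A hn
    simp only
    rw [← smul_mul_assoc, qint_smul_dpn_succ, mul_assoc, ih, Finset.mul_sum, Finset.smul_sum]
    set P : ℕ → A := fun s => (qint ((n + 1 : ℕ) - (s : ℤ)) * (qfact s)⁻¹) •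
      (dpnSub G t s * KbrProd k k' s ((s : ℤ) - n - t - 2) * dpn E (n + 1 - s)) with hP
    set Q : ℕ → A := fun s => (qint s * (qfact s)⁻¹) •
      (dpnSub G t s * Kbr k k' ((s : ℤ) - t) * KbrProd k k' (s - 1) ((s : ℤ) - 1 - n - t)
        * dpn E (n + 1 - s)) with hQ
    have hterm : ∀ s ∈ Finset.range (n + 1),
        E * ((qfact s)⁻¹ • (dpnSub G t s * KbrProd k k' s ((s : ℤ) - n - t) * dpn E (n - s)))
          = P s + Q (s + 1) := by
      intro s hs
      have hs : s ≤ n := Nat.lt_succ_iff.mp (Finset.mem_range.mp hs)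
      have hEs := qint_smul_dpn_succ E (n - s)
      rw [← Nat.sub_add_comm hs, Nat.cast_sub (by omega)] at hEs
      have hf : qint ((s + 1 : ℕ) : ℤ) * (qfact (s + 1))⁻¹ = (qfact s)⁻¹ := by
        rw [qfact_succ, mul_inv, mul_left_comm,
          mul_inv_cancel₀ (qint_natCast_ne_zero s.succ_ne_zero), mul_one]
      simp only [hP, hQ]
      rw [hf, mul_comm (qint _), mul_smul _ (qint _), ← mul_smul_comm (qint _), hEs,
        mul_smul_comm (qfact s)⁻¹ E, ← smul_add]
      congr 1
      rw [← mul_assoc, ← mul_assoc, mul_dpnSub_of_sl2 hG hG' hEG, add_mul, add_mul,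
        mul_assoc (dpnSub G t s) E, mul_KbrProd_of_skew hE hE']
      simp only [← mul_assoc, Nat.add_sub_cancel, Nat.add_sub_add_right]
      push_cast
      simp only [add_sub_cancel_right]
    have hsum : ∀ s ∈ Finset.range (n + 1 + 1), qint ((n + 1 : ℕ) : ℤ) • (qfact s)⁻¹ •
        (dpnSub G t s * KbrProd k k' s ((s : ℤ) - (n + 1 : ℕ) - t) * dpn E (n + 1 - s))
          = P s + Q s := by
      intro s _
      simp only [hP, hQ]
      cases s with
      | zero => simp [KbrProd, qint_zero, smul_smul]
      | succ s =>
        have hK := Kbr_add k k' ((n : ℤ) - s) ((s : ℤ) + 1) ((s : ℤ) + 1 - t)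
        have ha : ((s + 1 : ℕ) : ℤ) - n - t - 2 + 1 = (s : ℤ) - n - t := by push_cast; ring
        have hb : ((s + 1 : ℕ) : ℤ) - (n + 1 : ℕ) - t = (s : ℤ) - n - t := by push_cast; ring
        have hd : ((s + 1 : ℕ) : ℤ) - 1 - n - t = (s : ℤ) - n - t := by push_cast; ring
        rw [hb, hd, KbrProd_succ k k' s, KbrProd_succ', ha,
          ← (Kbr_commute_KbrProd hc _ _ _).eq, Nat.add_sub_cancel]
        have hm : qint ((n + 1 : ℕ) : ℤ) • Kbr k k' ((s : ℤ) - n - t + (s + 1))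
            = qint ((n + 1 : ℕ) - ((s + 1 : ℕ) : ℤ)) • Kbr k k' ((s : ℤ) - n - t)
              + qint ((s + 1 : ℕ) : ℤ) • Kbr k k' (((s + 1 : ℕ) : ℤ) - t) := by
          push_cast
          convert hK.symm using 3 <;> ring_nf
        rw [smul_comm, mul_comm (qint _), mul_comm (qint _), mul_smul, mul_smul, ← smul_add]
        congr 1
        simp only [mul_assoc]
        rw [← mul_smul_comm _ (dpnSub G t (s + 1)), ← mul_smul_comm _ (dpnSub G t (s + 1)),
          ← mul_smul_comm _ (dpnSub G t (s + 1)), ← mul_add, ← smul_mul_assoc, ← smul_mul_assoc,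
          ← smul_mul_assoc, ← add_mul, ← hm]
    have hP0 : P (n + 1) = 0 := by simp [hP, qint_zero]
    have hQ0 : Q 0 = 0 := by simp [hQ, qint_zero]
    rw [Finset.sum_congr rfl hterm, Finset.sum_congr rfl hsum, Finset.sum_add_distrib,
      Finset.sum_add_distrib, Finset.sum_range_succ P (n + 1), hP0, add_zero,
      Finset.sum_range_succ' Q, hQ0, add_zero]

/-- The commutation formula for divided powers in `U_q(sl₂)`, without vanishing terms. -/
lemma dpn_mul_dpn_of_sl2_min (h1 : k * k' = 1) (h2 : k' * k = 1)
    (hE : k * E = qz 2 • (E * k)) (hG : k * G = qz (-2) • (G * k))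
    (hEG : E * G - G * E = (qz 1 - qz (-1))⁻¹ • (k - k')) (n t : ℕ) :
    dpn E n * dpn G t = ∑ s ∈ Finset.range (min n t + 1),
      (qfact s)⁻¹ • (dpn G (t - s) * KbrProd k k' s ((s : ℤ) - n - t) * dpn E (n - s)) := by
  rw [dpn_mul_dpn_of_sl2 h1 h2 hE hG hEG]
  symm
  refine (Finset.sum_congr rfl fun s hs => ?_).trans
    (Finset.sum_subset (Finset.range_mono (by omega)) fun s hs hs' => ?_)
  · rw [dpnSub, if_pos]
    have := Finset.mem_range.mp hs
    omega
  · rw [dpnSub, if_neg, zero_mul, zero_mul, smul_zero]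
    simp only [Finset.mem_range] at hs hs'
    omega

end Sl2

end Uqsl3

/-- Lemma 5.18 (`lem:BBFF`) of the paper: in `U_q(sl₃)` (formalized by quantifying over all
algebras with generators satisfying its relations), for `b ≥ c`... in fact for all
`b, c ≥ 0`:
`B₂^{(b)}B₁^{(c)} = Σ_{l=0}^{b} Σ_{t=0}^{c} Σ_{s=0}^{min(b−l,t)}
  ς₂^{b−l} q^{−(b−l)(b−3l+1+2t−2s)/2} q^{t(c−t)} (1/[s]!) ·
  F₂^{(l)} F₁^{(t−s)} K₂^{l−b} (∏_{j=1}^{s}[K₁; s+l−b−t+j]) E₁^{(b−l−s)} (ς₁E₂K₁^{−1})^{(c−t)}`. -/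
theorem statement17 (A : Type*) [Ring A] [Algebra F A]
    (E1 E2 F1 F2 K1 K1' K2 K2' : A)
    (hK1 : K1 * K1' = 1) (hK1i : K1' * K1 = 1)
    (hK2 : K2 * K2' = 1) (hK2i : K2' * K2 = 1)
    (hKK : K1 * K2 = K2 * K1)
    (hK1E1 : K1 * E1 = qz 2 • (E1 * K1))
    (hK1E2 : K1 * E2 = qz (-1) • (E2 * K1))
    (hK2E1 : K2 * E1 = qz (-1) • (E1 * K2))
    (hK2E2 : K2 * E2 = qz 2 • (E2 * K2))
    (hK1F1 : K1 * F1 = qz (-2) • (F1 * K1))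
    (hK1F2 : K1 * F2 = qz 1 • (F2 * K1))
    (hK2F1 : K2 * F1 = qz 1 • (F1 * K2))
    (hK2F2 : K2 * F2 = qz (-2) • (F2 * K2))
    (hE1F1 : E1 * F1 - F1 * E1 = (qz 1 - qz (-1))⁻¹ • (K1 - K1'))
    (hE2F2 : E2 * F2 - F2 * E2 = (qz 1 - qz (-1))⁻¹ • (K2 - K2'))
    (hE1F2 : E1 * F2 = F2 * E1)
    (hE2F1 : E2 * F1 = F1 * E2)
    (hSe12 : E1 ^ 2 * E2 - qint 2 • (E1 * E2 * E1) + E2 * E1 ^ 2 = 0)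
    (hSe21 : E2 ^ 2 * E1 - qint 2 • (E2 * E1 * E2) + E1 * E2 ^ 2 = 0)
    (hSf12 : F1 ^ 2 * F2 - qint 2 • (F1 * F2 * F1) + F2 * F1 ^ 2 = 0)
    (hSf21 : F2 ^ 2 * F1 - qint 2 • (F2 * F1 * F2) + F1 * F2 ^ 2 = 0)
    (s1 s2 : F) (hs1 : s1 ≠ 0) (hs2 : s2 ≠ 0)
    (B1 B2 : A) (hB1 : B1 = F1 + s1 • (E2 * K1')) (hB2 : B2 = F2 + s2 • (E1 * K2'))
    (b c : ℕ) :
    dpn B2 b * dpn B1 c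
      = ∑ l ∈ Finset.range (b + 1), ∑ t ∈ Finset.range (c + 1),
          ∑ s ∈ Finset.range (min (b - l) t + 1),
            (s2 ^ (b - l) *
                qz (-(((b : ℤ) - l) * ((b : ℤ) - 3 * l + 1 + 2 * t - 2 * s)) / 2) *
                qz ((t : ℤ) * ((c : ℤ) - t)) * (qfact s)⁻¹) •
              (dpn F2 l * dpn F1 (t - s) * K2' ^ (b - l) *
                ((List.range s).map
                    (fun j => Kbr K1 K1' ((s : ℤ) + l - b - t + ((j : ℤ) + 1)))).prod *
                dpn E1 (b - l - s) * dpn (s1 • (E2 * K1')) (c - t)) := by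
  have hY : (s1 • (E2 * K1')) * F1 = qz 2 • (F1 * (s1 • (E2 * K1'))) := by
    rw [smul_mul_assoc, mul_assoc, inv_mul_of_skew hK1 hK1i hK1F1, mul_smul_comm, ← mul_assoc,
      hE2F1, mul_smul_comm, smul_comm, mul_assoc, neg_neg]
  have hX : (s2 • (E1 * K2')) * F2 = qz 2 • (F2 * (s2 • (E1 * K2'))) := by
    rw [smul_mul_assoc, mul_assoc, inv_mul_of_skew hK2 hK2i hK2F2, mul_smul_comm, ← mul_assoc,
      hE1F2, mul_smul_comm, smul_comm, mul_assoc, neg_neg]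
  rw [hB1, hB2, dpn_add_of_skew hX, dpn_add_of_skew hY,
    Finset.Nat.sum_antidiagonal_eq_sum_range_succ_mk,
    Finset.Nat.sum_antidiagonal_eq_sum_range_succ_mk, Finset.sum_mul]
  refine Finset.sum_congr rfl fun l hl => ?_
  rw [Finset.mul_sum]
  refine Finset.sum_congr rfl fun t ht => ?_
  have hl : l ≤ b := Nat.lt_succ_iff.mp (Finset.mem_range.mp hl)
  have ht : t ≤ c := Nat.lt_succ_iff.mp (Finset.mem_range.mp ht)
  obtain ⟨n, rfl⟩ := Nat.exists_eq_add_of_le hl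
  simp only [Nat.add_sub_cancel_left]
  rw [dpn_mul_of_skew (mul_inv_of_skew hK2 hK2i hK2E1)]
  have hreorder : ∀ (u v w x y : A) (p r z : F),
      p • (u * z • (v * w)) * r • (x * y) = (p * z * r) • (u * (v * (w * x) * y)) := by
    intro u v w x y p r z
    simp only [mul_smul_comm, smul_mul_assoc, smul_smul, mul_assoc]
    congr 1
    ring
  rw [hreorder, dpn_mul_dpn_of_sl2_min hK1 hK1i hK1E1 hK1F1 hE1F1, Finset.mul_sum, Finset.sum_mul,
    Finset.mul_sum, Finset.smul_sum]
  refine Finset.sum_congr rfl fun s hs => ?_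
  have hst : s ≤ t := by
    have := Finset.mem_range.mp hs
    omega
  have hKF : K2' ^ n * dpn F1 (t - s)
      = qz (-((n : ℤ) * (t - s))) • (dpn F1 (t - s) * K2' ^ n) := by
    rw [dpn, mul_smul_comm, pow_mul_pow_of_skew (inv_mul_of_skew hK2 hK2i hK2F1), smul_mul_assoc,
      smul_comm, ← qz_natCast_mul]
    congr 2
    push_cast [Nat.cast_sub hst]
    ring
  have hP : ((List.range s).map
      (fun j => Kbr K1 K1' ((s : ℤ) + l - (l + n : ℕ) - t + ((j : ℤ) + 1)))).prod
      = KbrProd K1 K1' s ((s : ℤ) - n - t) := by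
    simp only [KbrProd, List.bind_eq_flatMap, List.pure_def, ← List.map_eq_flatMap, List.map_map]
    refine congrArg (fun f => (List.map f (List.range s)).prod) (funext fun j => ?_)
    simp only [Function.comp]
    congr 1
    push_cast
    ring
  have hexp : -((((l + n : ℕ) : ℤ) - l) * (((l + n : ℕ) : ℤ) - 3 * l + 1 + 2 * t - 2 * s)) / 2
      = (l : ℤ) * n + -((n : ℤ) * (n + 1)) / 2 + -((n : ℤ) * (t - s)) := by
    have : -((((l + n : ℕ) : ℤ) - l) * (((l + n : ℕ) : ℤ) - 3 * l + 1 + 2 * t - 2 * s))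
        = -((n : ℤ) * (n + 1)) + (n * l - n * (t - s)) * 2 := by push_cast; ring
    rw [this, Int.add_mul_ediv_right _ _ two_ne_zero]
    ring
  rw [hP, hexp, mul_smul_comm, smul_mul_assoc, mul_smul_comm, smul_smul,
    ← mul_assoc (K2' ^ n), ← mul_assoc (K2' ^ n), hKF]
  simp only [smul_mul_assoc, mul_smul_comm, smul_smul, mul_assoc]
  congr 1
  rw [Nat.cast_sub ht, qz_add, qz_add]
  ring
end
end

section
/- With P and N the coefficient arrays of the context (the transition coefficients between the families B₁^{(t)}B₂^{(t+l+r)}B₁^{(l)}η and F₁^{(t)}F₂^{(t+l+r)}F₁^{(l)}η on a highest weight vector η of weight (m,n)), the array N is a right inverse of P: for all pairs (a,c), (i,j) ∈ ℕ², Σ_{(t,l) ∈ ℕ²} P((a,c),(t,l)) · N((t,l),(i,j)) equals 1 if (a,c) = (i,j) and equals 0 otherwise; the sum has only finitely many nonzero terms. -/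
noncomputable section

namespace Trans

/-- The base field `F = ℚ(q)`. -/
abbrev F : Type := RatFunc ℚ

/-- `q^e` for `e : ℤ`. -/
def qz (e : ℤ) : F := (RatFunc.X : F) ^ e

/-- The balanced Gaussian binomial `⌊a ¦ k⌋ = ∏_{s=1}^{k}(q^{a−s+1}−q^{−a+s−1})/(q^s−q^{−s})`. -/
def qbinom (a : ℤ) (k : ℕ) : F :=
  ∏ s ∈ Finset.range k,
    (qz (a - s) - qz (-(a - s))) / (qz ((s : ℤ) + 1) - qz (-((s : ℤ) + 1)))

/-- The transition coefficients `P((a,c),(t,l))` expressing `B₁^{(a)}B₂^{(a+c+r)}B₁^{(c)}η`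
in terms of `F₁^{(t)}F₂^{(t+l+r)}F₁^{(l)}η` (eq. (5.27) of the paper). -/
def Pc (m n r : ℕ) (s1 s2 : F) (ac tl : ℕ × ℕ) : F :=
  if tl.1 ≤ ac.1 ∧ tl.2 ≤ ac.2 then
    s1 ^ (ac.1 - tl.1) * s2 ^ (ac.2 - tl.2) *
      qz (-(((ac.2 : ℤ) - tl.2) * ((ac.2 : ℤ) - tl.2 + 1 + 2 * n - 2 * ac.1 - 2 * r)) / 2 -
          (((ac.1 : ℤ) - tl.1) * (2 * m + 2 * r - 2 * (tl.2 : ℤ) + (ac.1 : ℤ) - tl.1 + 1)) / 2) *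
      qbinom ((n : ℤ) - r - tl.1) (ac.1 - tl.1) * qbinom ((m : ℤ) - tl.2) (ac.2 - tl.2)
  else 0

/-- The inverse transition coefficients `N((a,c),(t,l))` expressing
`F₁^{(a)}F₂^{(a+c+r)}F₁^{(c)}η` in terms of `B₁^{(t)}B₂^{(t+l+r)}B₁^{(l)}η`
(Proposition 5.22 of the paper). -/
def Nc (m n r : ℕ) (s1 s2 : F) (ac tl : ℕ × ℕ) : F :=
  if tl.1 ≤ ac.1 ∧ tl.2 ≤ ac.2 then
    (-1 : F) ^ (ac.1 - tl.1 + (ac.2 - tl.2)) *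
      s1 ^ (ac.1 - tl.1) * s2 ^ (ac.2 - tl.2) *
      qz ((((ac.1 : ℤ) - tl.1) *
              (-2 * m - 3 - 2 * r + 2 * (tl.2 : ℤ) + (ac.1 : ℤ) - tl.1)) / 2 +
          (((ac.2 : ℤ) - tl.2) *
              (-2 * n - 3 + 2 * r + 2 * (ac.1 : ℤ) + (ac.2 : ℤ) - tl.2)) / 2) *
      qbinom ((n : ℤ) - r - tl.1) (ac.1 - tl.1) * qbinom ((m : ℤ) - tl.2) (ac.2 - tl.2)
  else 0

end Trans

open Trans

namespace Trans

/-- The unnormalised quantum integer `q^a − q^{−a}`. -/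
def qdiff (a : ℤ) : F := qz a - qz (-a)

lemma qz_add (a b : ℤ) : qz (a + b) = qz a * qz b :=
  zpow_add₀ RatFunc.X_ne_zero a b

lemma qz_zero : qz 0 = 1 := zpow_zero _

lemma qz_ne_one {k : ℕ} (hk : k ≠ 0) : qz k ≠ 1 := by
  intro h
  rw [qz, zpow_natCast, ← RatFunc.algebraMap_X, ← map_pow,
    ← map_one (algebraMap (Polynomial ℚ) (RatFunc ℚ))] at h
  have h' := congrArg Polynomial.natDegree (RatFunc.algebraMap_injective ℚ h)
  simp [hk] at h'

lemma qdiff_succ_ne_zero (k : ℕ) : qdiff ((k : ℤ) + 1) ≠ 0 := by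
  intro h
  refine qz_ne_one (k := 2 * (k + 1)) (by omega) ?_
  have h' : qz ((k : ℤ) + 1) = qz (-((k : ℤ) + 1)) := sub_eq_zero.mp h
  calc qz ((2 * (k + 1) : ℕ) : ℤ) = qz ((k : ℤ) + 1) * qz ((k : ℤ) + 1) := by
        rw [← qz_add]; congr 1; push_cast; ring
    _ = qz (-((k : ℤ) + 1)) * qz ((k : ℤ) + 1) := by rw [← h']
    _ = 1 := by rw [← qz_add, neg_add_cancel, qz_zero]

lemma qbinom_zero (a : ℤ) : qbinom a 0 = 1 := by simp [qbinom]

lemma qbinom_succ (a : ℤ) (k : ℕ) :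
    qbinom a (k + 1) = qbinom a k * (qdiff (a - k) / qdiff ((k : ℤ) + 1)) :=
  Finset.prod_range_succ _ _

lemma qbinom_add_one_succ (a : ℤ) (k : ℕ) :
    qbinom (a + 1) (k + 1) = qdiff (a + 1) / qdiff ((k : ℤ) + 1) * qbinom a k := by
  induction k with
  | zero => rw [qbinom_succ, qbinom_zero, qbinom_zero]; simp
  | succ k ih =>
    rw [qbinom_succ (a + 1) (k + 1), ih, qbinom_succ a k]
    have h : a + 1 - ((k + 1 : ℕ) : ℤ) = a - k := by push_cast; ring
    rw [h]
    ring

lemma qbinom_add_one_mul (a : ℤ) (k : ℕ) :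
    qbinom (a + 1) k * qdiff (a + 1 - k) = qdiff (a + 1) * qbinom a k := by
  have h := qbinom_add_one_succ a k
  rw [qbinom_succ] at h
  have hk := qdiff_succ_ne_zero k
  field_simp at h
  exact h

lemma qbinom_self_succ (k : ℕ) : qbinom (k : ℤ) (k + 1) = 0 := by
  rw [qbinom_succ, sub_self]
  simp [qdiff]

lemma qbinom_pascal (a : ℤ) (k : ℕ) :
    qbinom (a + 1) (k + 1) =
      qz ((k : ℤ) + 1) * qbinom a (k + 1) + qz (k - a) * qbinom a k := by
  have hk := qdiff_succ_ne_zero k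
  have hq : qdiff (a + 1) =
      qz ((k : ℤ) + 1) * qdiff (a - k) + qz (k - a) * qdiff ((k : ℤ) + 1) := by
    simp only [qdiff, mul_sub, ← qz_add]
    ring_nf
  rw [qbinom_add_one_succ, qbinom_succ, hq]
  field_simp

lemma qbinom_mul_qbinom (a : ℤ) (k h : ℕ) :
    qbinom (a - k) h * qbinom a k = qbinom a (k + h) * qbinom ((k + h : ℕ) : ℤ) k := by
  induction h with
  | zero =>
    have hk : qbinom (k : ℤ) k = 1 := by
      induction k with
      | zero => exact qbinom_zero _
      | succ k ih =>
        push_cast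
        rw [qbinom_add_one_succ, ih, mul_one, div_self (qdiff_succ_ne_zero k)]
    simp [hk, qbinom_zero]
  | succ h ih =>
    have h1 := qdiff_succ_ne_zero h
    have h2 := qdiff_succ_ne_zero (k + h)
    have h3 := qbinom_add_one_mul ((k + h : ℕ) : ℤ) k
    have e1 : ((k + h : ℕ) : ℤ) + 1 - k = (h : ℤ) + 1 := by push_cast; ring
    have e2 : a - k - h = a - (k + h : ℕ) := by push_cast; ring
    rw [e1] at h3
    rw [← add_assoc, qbinom_succ, qbinom_succ a (k + h), Nat.cast_succ (k + h), e2]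
    field_simp
    linear_combination (qdiff (a - (k + h : ℕ)) * qdiff (((k + h : ℕ) : ℤ) + 1)) * ih
      - (qbinom a (k + h) * qdiff (a - (k + h : ℕ))) * h3

/-- The summand of the alternating `q`-binomial sum `Σ_k (−1)^k q^{(A−1)k} ⌊A ¦ k⌋`. -/
def altTerm (A k : ℕ) : F := (-1) ^ k * qz (((A : ℤ) - 1) * k) * qbinom A k

lemma sum_altTerm_succ (A K : ℕ) :
    ∑ k ∈ Finset.range (K + 1), altTerm (A + 1) k =
      (-1) ^ K * qz (((A : ℤ) + 1) * K) * qbinom A K := by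
  induction K with
  | zero => simp [altTerm, qbinom_zero, qz_zero]
  | succ K ih =>
    rw [Finset.sum_range_succ, ih, altTerm]
    push_cast
    rw [qbinom_pascal]
    have e1 : qz (((A : ℤ) + 1) * ((K : ℤ) + 1)) =
        qz (((A : ℤ) + 1 - 1) * ((K : ℤ) + 1)) * qz ((K : ℤ) + 1) := by
      rw [← qz_add]; ring_nf
    have e2 : qz (((A : ℤ) + 1) * K) =
        qz (((A : ℤ) + 1 - 1) * ((K : ℤ) + 1)) * qz (K - A) := by
      rw [← qz_add]; ring_nf
    rw [e1, e2]
    ring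

lemma sum_altTerm (A : ℕ) :
    ∑ k ∈ Finset.range (A + 1), altTerm A k = if A = 0 then 1 else 0 := by
  cases A with
  | zero => simp [altTerm, qbinom_zero, qz_zero]
  | succ A => simp [sum_altTerm_succ, qbinom_self_succ]

lemma exponent_add (A k p C u v M L i : ℤ) (hA : A = k + p) (hC : C = u + v) :
    -(v * (v + 1 + 2 * (L - i - A))) / 2 - (p * (2 * (M - u) + p + 1)) / 2
      + ((k * (-2 * M - 3 + k)) / 2 + (u * (-2 * L - 3 + 2 * (i + k) + u)) / 2)
      = (-(A * (2 * M + A + 1)) / 2 + -(C * (2 * (L - i - A) + C + 1)) / 2)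
        + ((A - 1) * k + (C - 1) * u) := by
  subst hA hC
  obtain ⟨x, hx⟩ := Int.even_mul_succ_self v
  obtain ⟨y, hy⟩ := Int.even_mul_succ_self p
  obtain ⟨z, hz⟩ := Int.even_mul_succ_self k
  obtain ⟨w, hw⟩ := Int.even_mul_succ_self u
  have half {a b : ℤ} (h : a = 2 * b) : a / 2 = b := by omega
  rw [half (b := -x - v * (L - i - (k + p))) (by linear_combination -hx),
    half (b := y + p * (M - u)) (by linear_combination hy),
    half (b := z - 2 * k - k * M) (by linear_combination hz),
    half (b := w - 2 * u - u * L + u * (i + k)) (by linear_combination hw),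
    half (b := -y - z - k * p - (k + p) * M) (by linear_combination -hy - hz),
    half (b := -x - w - u * v - (u + v) * (L - i - (k + p))) (by linear_combination -hx - hw)]
  linear_combination -hz - hw

/-- The part of `P((i+A,j+C),(t,l)) · N((t,l),(i,j))` that does not depend on `(t,l)`. -/
def pairFactor (m n r : ℕ) (s1 s2 : F) (i j A C : ℕ) : F :=
  s1 ^ A * s2 ^ C *
    qz (-((A : ℤ) * (2 * ((m : ℤ) + r - j) + A + 1)) / 2 +
      -((C : ℤ) * (2 * ((n : ℤ) - r - i - A) + C + 1)) / 2) *
    qbinom ((n : ℤ) - r - i) A * qbinom ((m : ℤ) - j) C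

lemma pairFactor_zero_zero (m n r : ℕ) (s1 s2 : F) (i j : ℕ) :
    pairFactor m n r s1 s2 i j 0 0 = 1 := by
  simp [pairFactor, qbinom_zero, qz_zero]

lemma Pc_mul_Nc (m n r : ℕ) (s1 s2 : F) (i j k p u v : ℕ) :
    Pc m n r s1 s2 (i + (k + p), j + (u + v)) (i + k, j + u) *
        Nc m n r s1 s2 (i + k, j + u) (i, j) =
      pairFactor m n r s1 s2 i j (k + p) (u + v) * (altTerm (k + p) k * altTerm (u + v) u) := by
  have hq1 := qbinom_mul_qbinom ((n : ℤ) - r - i) k p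
  have hq2 := qbinom_mul_qbinom ((m : ℤ) - j) u v
  have he := congrArg qz (exponent_add ((k + p : ℕ) : ℤ) k p ((u + v : ℕ) : ℤ) u v
    ((m : ℤ) + r - j) ((n : ℤ) - r) i (by push_cast; rfl) (by push_cast; rfl))
  rw [qz_add, qz_add _ ((((k + p : ℕ) : ℤ) - 1) * k + _),
    qz_add ((((k + p : ℕ) : ℤ) - 1) * k)] at he
  have hP : Pc m n r s1 s2 (i + (k + p), j + (u + v)) (i + k, j + u) =
      s1 ^ p * s2 ^ v *
        qz (-((v : ℤ) * (v + 1 + 2 * ((n : ℤ) - r - i - (k + p : ℕ)))) / 2 -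
          ((p : ℤ) * (2 * ((m : ℤ) + r - j - u) + p + 1)) / 2) *
        qbinom ((n : ℤ) - r - i - k) p * qbinom ((m : ℤ) - j - u) v := by
    have e1 : i + (k + p) - (i + k) = p := by omega
    have e2 : j + (u + v) - (j + u) = v := by omega
    rw [Pc, if_pos (by constructor <;> dsimp only <;> omega)]
    dsimp only
    rw [e1, e2]
    refine congrArg₂ (· * ·) (congrArg₂ (· * ·) (congrArg (_ * qz ·) ?_)
      (congrArg (qbinom · _) ?_)) (congrArg (qbinom · _) ?_) <;> push_cast <;> ring_nf
  have hN : Nc m n r s1 s2 (i + k, j + u) (i, j) =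
      (-1) ^ (k + u) * s1 ^ k * s2 ^ u *
        qz (((k : ℤ) * (-2 * ((m : ℤ) + r - j) - 3 + k)) / 2 +
          ((u : ℤ) * (-2 * ((n : ℤ) - r) - 3 + 2 * (i + k) + u)) / 2) *
        qbinom ((n : ℤ) - r - i) k * qbinom ((m : ℤ) - j) u := by
    rw [Nc, if_pos (by constructor <;> dsimp only <;> omega)]
    dsimp only
    rw [Nat.add_sub_cancel_left, Nat.add_sub_cancel_left]
    refine congrArg (_ * qz · * _ * _) ?_
    push_cast
    ring_nf
  rw [hP, hN, pairFactor, altTerm, altTerm]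
  have hprod := congrArg₂ (· * ·) he (congrArg₂ (· * ·) hq1 hq2)
  linear_combination s1 ^ (k + p) * s2 ^ (u + v) * (-1) ^ (k + u) * hprod

end Trans

/-- Proposition 5.22 (`prop:FB`) of the paper, reformulated: the coefficient array `N` is a
right inverse of the coefficient array `P`:
`Σ_{(t,l)} P((a,c),(t,l))·N((t,l),(i,j)) = δ_{(a,c),(i,j)}`. -/
theorem statement19 (m n r : ℕ) (s1 s2 : F) (hs1 : s1 ≠ 0) (hs2 : s2 ≠ 0)
    (ac ij : ℕ × ℕ) :
    ∑ᶠ tl : ℕ × ℕ, Pc m n r s1 s2 ac tl * Nc m n r s1 s2 tl ij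
      = if ac = ij then 1 else 0 := by
  obtain ⟨a, c⟩ := ac
  obtain ⟨i, j⟩ := ij
  by_cases h : i ≤ a ∧ j ≤ c
  · obtain ⟨⟨A, rfl⟩, ⟨C, rfl⟩⟩ := And.imp Nat.exists_eq_add_of_le Nat.exists_eq_add_of_le h
    rw [finsum_eq_sum_of_support_subset
      (s := Finset.Ico i (i + A + 1) ×ˢ Finset.Ico j (j + C + 1))]
    · have hterm : ∀ k ∈ Finset.range (A + 1), ∀ u ∈ Finset.range (C + 1),
          Pc m n r s1 s2 (i + A, j + C) (i + k, j + u) *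
              Nc m n r s1 s2 (i + k, j + u) (i, j) =
            pairFactor m n r s1 s2 i j A C * (altTerm A k * altTerm C u) := by
        intro k hk u hu
        obtain ⟨p, rfl⟩ := Nat.exists_eq_add_of_le (Finset.mem_range_succ_iff.mp hk)
        obtain ⟨v, rfl⟩ := Nat.exists_eq_add_of_le (Finset.mem_range_succ_iff.mp hu)
        exact Pc_mul_Nc m n r s1 s2 i j k p u v
      have hsum : ∑ k ∈ Finset.range (A + 1), ∑ u ∈ Finset.range (C + 1),
          Pc m n r s1 s2 (i + A, j + C) (i + k, j + u) *
              Nc m n r s1 s2 (i + k, j + u) (i, j) =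
            pairFactor m n r s1 s2 i j A C *
              ((if A = 0 then 1 else 0) * (if C = 0 then 1 else 0)) := by
        rw [Finset.sum_congr rfl fun k hk => Finset.sum_congr rfl (hterm k hk),
          ← sum_altTerm, ← sum_altTerm, Finset.sum_mul_sum, Finset.mul_sum]
        simp only [Finset.mul_sum]
      rw [Finset.sum_product, Finset.sum_Ico_eq_sum_range]
      simp only [Finset.sum_Ico_eq_sum_range, add_assoc, Nat.add_sub_cancel_left]
      rw [hsum]
      by_cases hA : A = 0
      · by_cases hC : C = 0
        · subst hA hC
          simp [pairFactor_zero_zero]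
        · simp [hC]
      · simp [hA]
    · rintro ⟨t, l⟩ htl
      have hP : t ≤ i + A ∧ l ≤ j + C := by
        by_contra hn
        exact htl (by simp only [Pc, if_neg hn, zero_mul])
      have hN : i ≤ t ∧ j ≤ l := by
        by_contra hn
        exact htl (by simp only [Nc, if_neg hn, mul_zero])
      simp only [Finset.coe_product, Set.mem_prod, Finset.mem_coe, Finset.mem_Ico]
      omega
  · have hne : (a, c) ≠ (i, j) := by
      rintro ⟨⟩
      exact h ⟨le_rfl, le_rfl⟩
    rw [if_neg hne, ← finsum_zero]
    refine finsum_congr fun tl => ?_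
    by_cases hP : tl.1 ≤ a ∧ tl.2 ≤ c
    · rw [Nc, if_neg fun hN => h ⟨hN.1.trans hP.1, hN.2.trans hP.2⟩, mul_zero]
    · rw [Pc, if_neg hP, zero_mul]
end
end
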